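/- arXiv:2108.12888 — 6 statements merged into one kernel-verified Lean document; each statement's English description precedes it below -/
import Mathlib

section
/- Let ã ∈ X, b̃ ∈ W, suppose S(b̃) = {x ∈ C : E x = b̃} is nonempty, and let x̄ be the unique minimizer of J̃(x) = ½⟨A x, x⟩ + ⟨ã, x⟩ over S(b̃). If moreover the regular point condition 0 ∈ int E(C − x̄) holds (interior taken in W), then there exists a Lagrange multiplier λ ∈ W such that ⟨A x̄ + ã + E*λ, c − x̄⟩ ≥ 0 for all c ∈ C, together with E x̄ = b̃. -/
open scoped RealInnerProductSpace
open Filter Topology Metric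
open scoped Pointwise

section HilbertConvex

variable {X W : Type*} [NormedAddCommGroup X] [InnerProductSpace ℝ X] [CompleteSpace X]

/-- A decreasing sequence of closed convex sets in a Hilbert space, each meeting a fixed closed
ball, has a common point in that ball. -/
theorem exists_norm_le_of_antitone_of_isClosed_of_convex {F : ℕ → Set X} (hF : Antitone F)
    (hcl : ∀ n, IsClosed (F n)) (hcv : ∀ n, Convex ℝ (F n)) {R : ℝ}
    (hR : ∀ n, ∃ x ∈ F n, ‖x‖ ≤ R) : ∃ x, (∀ n, x ∈ F n) ∧ ‖x‖ ≤ R := by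
  have hmin : ∀ n, ∃ x ∈ F n, ∀ y ∈ F n, ‖x‖ ≤ ‖y‖ := by
    intro n
    obtain ⟨z, hz, -⟩ := hR n
    obtain ⟨x, hx, h⟩ :=
      exists_norm_eq_iInf_of_complete_convex ⟨z, hz⟩ (hcl n).isComplete (hcv n) 0
    refine ⟨x, hx, fun y hy => ?_⟩
    have hle : ⨅ w : F n, ‖(0 : X) - w‖ ≤ ‖(0 : X) - y‖ :=
      ciInf_le ⟨0, by rintro _ ⟨w, rfl⟩; exact norm_nonneg _⟩ (⟨y, hy⟩ : F n)
    rw [← h] at hle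
    simpa using hle
  choose x hxF hxmin using hmin
  have hxR : ∀ n, ‖x n‖ ≤ R := fun n => by
    obtain ⟨z, hz, hzR⟩ := hR n
    exact (hxmin n z hz).trans hzR
  have hmono : Monotone fun n => ‖x n‖ ^ 2 := fun n m hnm =>
    pow_le_pow_left₀ (norm_nonneg _) (hxmin n _ (hF hnm (hxF m))) 2
  have hbdd : BddAbove (Set.range fun n => ‖x n‖ ^ 2) :=
    ⟨R ^ 2, by rintro _ ⟨n, rfl⟩; exact pow_le_pow_left₀ (norm_nonneg _) (hxR n) 2⟩
  set L := ⨆ n, ‖x n‖ ^ 2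
  have hL : Tendsto (fun n => ‖x n‖ ^ 2) atTop (𝓝 L) := tendsto_atTop_ciSup hmono hbdd
  have hcauchy : CauchySeq x := by
    refine cauchySeq_of_le_tendsto_0' (fun n => √(2 * (L - ‖x n‖ ^ 2))) (fun n m hnm => ?_) ?_
    · rw [dist_eq_norm]
      refine Real.le_sqrt_of_sq_le ?_
      have hmid : (1 / 2 : ℝ) • x n + (1 / 2 : ℝ) • x m ∈ F n :=
        hcv n (hxF n) (hF hnm (hxF m)) (by norm_num) (by norm_num) (by norm_num)
      have h1 := hxmin n _ hmid
      rw [← smul_add, norm_smul, Real.norm_of_nonneg (by norm_num)] at h1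
      have h2 := parallelogram_law_with_norm ℝ (x n) (x m)
      have h3 : ‖x m‖ ^ 2 ≤ L := le_ciSup hbdd m
      nlinarith [norm_nonneg (x n)]
    · have : Tendsto (fun n => √(2 * (L - ‖x n‖ ^ 2))) atTop (𝓝 √(2 * (L - L))) :=
        ((tendsto_const_nhds.sub hL).const_mul 2).sqrt
      simpa using this
  obtain ⟨l, hl⟩ := cauchySeq_tendsto_of_complete hcauchy
  refine ⟨l, fun n => (hcl n).mem_of_tendsto hl ?_, le_of_tendsto' hl.norm hxR⟩
  filter_upwards [eventually_ge_atTop n] with m hm using hF hm (hxF m)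

variable [NormedAddCommGroup W] [InnerProductSpace ℝ W]

/-- A continuous linear map on a Hilbert space sends bounded closed convex sets to closed sets. -/
theorem isClosed_image_inter_closedBall (E : X →L[ℝ] W) {D : Set X} (hcl : IsClosed D)
    (hcv : Convex ℝ D) (R : ℝ) : IsClosed (E '' (D ∩ closedBall 0 R)) := by
  refine isClosed_of_closure_subset fun y hy => ?_
  have key := exists_norm_le_of_antitone_of_isClosed_of_convex (R := R)
    (F := fun n : ℕ => D ∩ E ⁻¹' closedBall y (1 / ((n : ℝ) + 1)))
    (fun n m hnm => Set.inter_subset_inter_right _ <| Set.preimage_mono <|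
      closedBall_subset_closedBall <| Nat.one_div_le_one_div hnm)
    (fun n => hcl.inter (isClosed_closedBall.preimage E.continuous))
    (fun n => hcv.inter ((convex_closedBall _ _).linear_preimage E.toLinearMap))
    (fun n => by
      obtain ⟨_, ⟨x, ⟨hxD, hxR⟩, rfl⟩, hd⟩ :=
        Metric.mem_closure_iff.1 hy (1 / ((n : ℝ) + 1)) Nat.one_div_pos_of_nat
      rw [dist_comm] at hd
      exact ⟨x, ⟨hxD, hd.le⟩, by simpa using hxR⟩)
  obtain ⟨x, hx, hxR⟩ := key
  refine ⟨x, ⟨(hx 0).1, by simpa using hxR⟩, ?_⟩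
  refine dist_le_zero.1 (ge_of_tendsto' tendsto_one_div_add_atTop_nhds_zero_nat fun n => ?_)
  exact (hx n).2

/-- If the image of a closed convex set is a neighbourhood of the origin, then the image of one of
its bounded parts has interior points. -/
theorem exists_nonempty_interior_image_inter_closedBall [CompleteSpace W] (E : X →L[ℝ] W)
    {D : Set X} (hcl : IsClosed D) (hcv : Convex ℝ D) (hE : E '' D ∈ 𝓝 0) :
    ∃ R : ℝ, (interior (E '' (D ∩ closedBall 0 R))).Nonempty := by
  have hpos : ∀ m : ℕ, (m : ℝ) + 1 ≠ 0 := fun m => by positivity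
  obtain ⟨⟨m, n⟩, h⟩ := nonempty_interior_of_iUnion_of_closed
    (f := fun p : ℕ × ℕ => ((p.1 : ℝ) + 1) • (E '' (D ∩ closedBall 0 (p.2 : ℝ))))
    (fun p => (isClosed_image_inter_closedBall E hcl hcv _).smul_of_ne_zero (hpos _)) (by
      refine Set.eq_univ_of_forall fun w => ?_
      have ht : Tendsto (fun m : ℕ => (1 / ((m : ℝ) + 1)) • w) atTop (𝓝 0) := by
        simpa using (tendsto_one_div_add_atTop_nhds_zero_nat (𝕜 := ℝ)).smul_const w
      obtain ⟨m, d, hd, hdw⟩ := (ht.eventually_mem hE).exists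
      obtain ⟨n, hn⟩ := exists_nat_ge ‖d‖
      refine Set.mem_iUnion.2 ⟨(m, n), E d, ⟨d, ⟨hd, by simpa using hn⟩, rfl⟩, ?_⟩
      simp only [hdw]
      rw [smul_smul, mul_one_div_cancel (hpos m), one_smul])
  refine ⟨n, ?_⟩
  rw [interior_smul₀ (hpos m)] at h
  exact Set.smul_set_nonempty.1 h

/-- A linear functional that is nonnegative on `D ∩ ker E` becomes nonnegative on all of `D` after
adding a suitable functional of `E`, provided that `E '' D` is a neighbourhood of the origin. -/
theorem exists_lagrange_multiplier [CompleteSpace W] (E : X →L[ℝ] W) {D : Set X}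
    (hcl : IsClosed D) (hcv : Convex ℝ D) (h0 : (0 : X) ∈ D) (hE : E '' D ∈ 𝓝 0) (g : X)
    (hg : ∀ d ∈ D, E d = 0 → 0 ≤ ⟪g, d⟫) :
    ∃ lam : W, ∀ d ∈ D, 0 ≤ ⟪g, d⟫ + ⟪lam, E d⟫ := by
  set K : Set (W × ℝ) := {p | ∃ d ∈ D, E d = p.1 ∧ ⟪g, d⟫ < p.2}
  have hKcv : Convex ℝ K := by
    rintro ⟨w, s⟩ ⟨d, hd, rfl, hs⟩ ⟨w', s'⟩ ⟨d', hd', rfl, hs'⟩ α β hα hβ hαβ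
    refine ⟨α • d + β • d', hcv hd hd' hα hβ hαβ, by simp, ?_⟩
    simp only [inner_add_right, real_inner_smul_right, Prod.snd_add, Prod.smul_snd, smul_eq_mul]
      at hs hs' ⊢
    rcases hα.eq_or_lt with rfl | hα
    · obtain rfl : β = 1 := by linarith
      linarith
    · nlinarith [mul_lt_mul_of_pos_left hs hα, mul_le_mul_of_nonneg_left hs'.le hβ]
  have hKint : (interior K).Nonempty := by
    obtain ⟨R, hR⟩ := exists_nonempty_interior_image_inter_closedBall E hcl hcv hE
    refine (hR.prod (Set.nonempty_Ioi (a := ‖g‖ * R))).mono (interior_maximal ?_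
      (isOpen_interior.prod isOpen_Ioi))
    rintro ⟨w, s⟩ ⟨hw, hs⟩
    obtain ⟨d, ⟨hd, hdR⟩, rfl⟩ := interior_subset hw
    refine ⟨d, hd, rfl, lt_of_le_of_lt ?_ hs⟩
    exact (real_inner_le_norm g d).trans
      (mul_le_mul_of_nonneg_left (by simpa using hdR) (norm_nonneg g))
  have hK0 : (0 : W × ℝ) ∉ interior K := fun h => by
    obtain ⟨d, hd, hEd, hlt⟩ := interior_subset h
    exact absurd (hg d hd hEd) (not_le.2 hlt)
  obtain ⟨f, hf⟩ := geometric_hahn_banach_open_point hKcv.interior isOpen_interior hK0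
  rw [map_zero] at hf
  have hfK : ∀ p ∈ K, f p ≤ 0 := fun p hp => by
    have hp' : p ∈ closure (interior K) := by
      rw [hKcv.closure_interior_eq_closure_of_nonempty_interior hKint]
      exact subset_closure hp
    exact closure_minimal (fun q hq => (hf q hq).le)
      (isClosed_le f.continuous continuous_const) hp'
  set φ : W →L[ℝ] ℝ := f.comp (ContinuousLinearMap.inl ℝ W ℝ)
  set β : ℝ := f (0, 1)
  have hfs : ∀ w s, f (w, s) = φ w + s * β := fun w s => by
    have : ((w, s) : W × ℝ) = (w, 0) + s • (0, 1) := by simp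
    rw [this, map_add, map_smul]
    rfl
  have hle : ∀ d ∈ D, φ (E d) + ⟪g, d⟫ * β ≤ 0 := fun d hd => by
    have ht : Tendsto (fun s => φ (E d) + s * β) (𝓝[>] ⟪g, d⟫) (𝓝 (φ (E d) + ⟪g, d⟫ * β)) :=
      ((by fun_prop : Continuous fun s : ℝ => φ (E d) + s * β).tendsto _).mono_left
        nhdsWithin_le_nhds
    refine le_of_tendsto ht ?_
    filter_upwards [self_mem_nhdsWithin] with s hs
    rw [← hfs]
    exact hfK _ ⟨d, hd, rfl, hs⟩
  have hβ0 : β ≤ 0 := hfK _ ⟨0, h0, by simp, by simp⟩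
  have hβneg : β < 0 := by
    refine hβ0.lt_of_ne fun hzero => ?_
    have hφle : ∀ w ∈ E '' D, φ w ≤ 0 := by
      rintro _ ⟨d, hd, rfl⟩
      simpa [hzero] using hle d hd
    have hφmax : IsLocalMax φ 0 := by
      filter_upwards [hE] with w hw
      simpa using hφle w hw
    have hφ0 : φ = 0 := hφmax.hasFDerivAt_eq_zero φ.hasFDerivAt
    obtain ⟨⟨w, s⟩, hp⟩ := hKint
    have := hf _ hp
    rw [hfs, hφ0, hzero] at this
    simp at this
  refine ⟨(InnerProductSpace.toDual ℝ W).symm (β⁻¹ • φ), fun d hd => ?_⟩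
  rw [InnerProductSpace.toDual_symm_apply, smul_apply, smul_eq_mul]
  have h := mul_nonneg_of_nonpos_of_nonpos (inv_nonpos.2 hβ0) (hle d hd)
  have : β⁻¹ * (φ (E d) + ⟪g, d⟫ * β) = ⟪g, d⟫ + β⁻¹ * φ (E d) := by
    field_simp [hβneg.ne]
    ring
  rwa [this] at h

end HilbertConvex

/-- First-order condition along an admissible segment for a quadratic functional. -/
theorem inner_nonneg_of_quadratic_le_segment {X : Type*} [NormedAddCommGroup X]
    [InnerProductSpace ℝ X] [CompleteSpace X] {A : X →L[ℝ] X} (hA : IsSelfAdjoint A) (a x h : X)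
    (hmin : ∀ t : ℝ, 0 < t → t ≤ 1 → (1 / 2) * ⟪A x, x⟫ + ⟪a, x⟫ ≤
      (1 / 2) * ⟪A (x + t • h), x + t • h⟫ + ⟪a, x + t • h⟫) :
    0 ≤ ⟪A x + a, h⟫ := by
  have hsymm : ⟪A h, x⟫ = ⟪A x, h⟫ := by
    rw [real_inner_comm]
    exact (hA.isSymmetric x h).symm
  have ht : Tendsto (fun t : ℝ => ⟪A x + a, h⟫ + t * (⟪A h, h⟫ / 2)) (𝓝[>] 0)
      (𝓝 (⟪A x + a, h⟫ + 0 * (⟪A h, h⟫ / 2))) :=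
    ((by fun_prop : Continuous fun t : ℝ => ⟪A x + a, h⟫ + t * (⟪A h, h⟫ / 2)).tendsto 0).mono_left
      nhdsWithin_le_nhds
  rw [zero_mul, add_zero] at ht
  refine ge_of_tendsto ht ?_
  filter_upwards [Ioc_mem_nhdsGT one_pos] with t ht
  have key := hmin t ht.1 ht.2
  simp only [map_add, map_smul, inner_add_left, inner_add_right, real_inner_smul_left,
    real_inner_smul_right, hsymm] at key ⊢
  refine nonneg_of_mul_nonneg_right (a := t) ?_ ht.1
  linarith

/-- If `xbar` is the unique minimizer of `J̃(x) = ½⟨Ax,x⟩ + ⟨a,x⟩`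
over `S(bt) = {x ∈ C : E x = bt}` and the regular point condition
`0 ∈ int E(C − xbar)` holds, then there exists a Lagrange multiplier `lam ∈ W` such that
`⟨A xbar + a + E* lam, c − xbar⟩ ≥ 0` for all `c ∈ C`, together with `E xbar = bt`. -/
theorem stmt_1
    {X W : Type*} [NormedAddCommGroup X] [InnerProductSpace ℝ X] [CompleteSpace X]
    [NormedAddCommGroup W] [InnerProductSpace ℝ W] [CompleteSpace W]
    (A : X →L[ℝ] X) (hA : IsSelfAdjoint A)
    (E : X →L[ℝ] W)
    (C : Set X) (hCne : C.Nonempty) (hCcl : IsClosed C) (hCcv : Convex ℝ C)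
    (κ : ℝ) (hκ : 0 < κ)
    (hcoer : ∀ x : X, E x = 0 → κ * ‖x‖ ^ 2 ≤ ⟪A x, x⟫)
    (a : X) (bt : W)
    (hS : ∃ x ∈ C, E x = bt)
    (xbar : X) (hxbarC : xbar ∈ C) (hxbarE : E xbar = bt)
    (hmin : ∀ v ∈ C, E v = bt →
      (1 / 2) * ⟪A xbar, xbar⟫ + ⟪a, xbar⟫ ≤ (1 / 2) * ⟪A v, v⟫ + ⟪a, v⟫)
    (huniq : ∀ y : X, (y ∈ C ∧ E y = bt ∧
        ∀ v ∈ C, E v = bt →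
          (1 / 2) * ⟪A y, y⟫ + ⟪a, y⟫ ≤ (1 / 2) * ⟪A v, v⟫ + ⟪a, v⟫) → y = xbar)
    (hreg : (0 : W) ∈ interior ((fun c => E (c - xbar)) '' C)) :
    ∃ lam : W,
      (∀ c ∈ C, 0 ≤ ⟪A xbar + a + (ContinuousLinearMap.adjoint E) lam, c - xbar⟫) ∧
      E xbar = bt := by
  set D : Set X := (fun d => xbar + d) ⁻¹' C with hD
  have hDcl : IsClosed D := hCcl.preimage (by fun_prop)
  have hDcv : Convex ℝ D := hCcv.translate_preimage_right xbar
  have hD0 : (0 : X) ∈ D := by simpa [hD] using hxbarC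
  have hED : E '' D ∈ 𝓝 0 := by
    refine mem_of_superset (mem_interior_iff_mem_nhds.1 hreg) ?_
    rintro _ ⟨c, hc, rfl⟩
    exact ⟨c - xbar, by simpa [hD] using hc, rfl⟩
  obtain ⟨lam, hlam⟩ := exists_lagrange_multiplier E hDcl hDcv hD0 hED (A xbar + a)
    fun d hd hEd => inner_nonneg_of_quadratic_le_segment hA a xbar d fun t ht0 ht1 => by
      refine hmin _ ?_ (by simp [hEd, hxbarE])
      exact hDcv.smul_mem_of_zero_mem hD0 hd ⟨ht0.le, ht1⟩
  refine ⟨lam, fun c hc => ?_, hxbarE⟩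
  rw [inner_add_left, ContinuousLinearMap.adjoint_inner_left]
  exact hlam _ (by simpa [hD] using hc)
end

section
/- Assume (H0)–(H4). Then there exist a neighborhood U ⊆ X̲ × W̲ of (x₀, λ₀), a neighborhood N ⊆ P of q₀, and a constant μ > 0 such that: (i) for every q ∈ N there exists a unique pair (x(q), λ(q)) ∈ U satisfying the first-order optimality system ⟨L̲'(x(q), q, λ(q)), c − x(q)⟩ ≥ 0 for all c ∈ C ∩ X̲, together with e(x(q), q) = 0 in W; (ii) ‖(x(q₁), λ(q₁)) − (x(q₂), λ(q₂))‖_{X̲ × W̲} ≤ μ ‖q₁ − q₂‖_P for all q₁, q₂ ∈ N; and (iii) there exists a nontrivial neighborhood Ñ ⊆ N of q₀ such that for every q ∈ Ñ the point x(q) is a local solution of the problem (P_q): minimize f(x) subject to e(x, q) = 0 and x ∈ C. -/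
open scoped RealInnerProductSpace
open Filter Topology ContinuousLinearMap

/-- Parametric form of strict differentiability. -/
theorem exists_forall_norm_sub_sub_le {X Q Z : Type*} [NormedAddCommGroup X] [NormedSpace ℝ X]
    [PseudoMetricSpace Q] [NormedAddCommGroup Z] [NormedSpace ℝ Z]
    {F : X → Q → Z} {F' : X → Q → (X →L[ℝ] Z)} {x₀ : X} {q₀ : Q}
    (hF : ∀ᶠ p : X × Q in 𝓝 (x₀, q₀), HasFDerivAt (fun y => F y p.2) (F' p.1 p.2) p.1)
    (hc : ContinuousAt (fun p : X × Q => F' p.1 p.2) (x₀, q₀)) {ε : ℝ} (hε : 0 < ε) :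
    ∃ δ > 0, ∀ q ∈ Metric.ball q₀ δ, ∀ x ∈ Metric.ball x₀ δ, ∀ y ∈ Metric.ball x₀ δ,
      ‖F x q - F y q - F' x₀ q₀ (x - y)‖ ≤ ε * ‖x - y‖ := by
  obtain ⟨δ, hδ, h⟩ := Metric.eventually_nhds_iff.1
    (hF.and (hc.eventually (Metric.ball_mem_nhds _ hε)))
  refine ⟨δ, hδ, fun q hq x hx y hy => ?_⟩
  have key : ∀ z ∈ Metric.ball x₀ δ,
      HasFDerivAt (fun y => F y q) (F' z q) z ∧ dist (F' z q) (F' x₀ q₀) < ε := fun z hz =>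
    h (y := (z, q)) (max_lt hz hq)
  refine Convex.norm_image_sub_le_of_norm_hasFDerivWithin_le' (f := fun y => F y q)
    (f' := fun z => F' z q)
    (fun z hz => (key z hz).1.hasFDerivWithinAt) (fun z hz => ?_)
    (convex_ball x₀ δ) hy hx
  rw [← dist_eq_norm]
  exact (key z hz).2.le

theorem continuousAt_of_norm_sub_le_mul {Y Z : Type*} [SeminormedAddCommGroup Y]
    [SeminormedAddCommGroup Z] {F : Y → Z} {y₀ : Y} {K : ℝ}
    (h : ∀ᶠ y in 𝓝 y₀, ‖F y - F y₀‖ ≤ K * ‖y - y₀‖) : ContinuousAt F y₀ := by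
  rw [ContinuousAt, tendsto_iff_norm_sub_tendsto_zero]
  refine squeeze_zero' (Eventually.of_forall fun _ => norm_nonneg _) h ?_
  have : Tendsto (fun y => K * ‖y - y₀‖) (𝓝 y₀) (𝓝 (K * ‖y₀ - y₀‖)) :=
    (Continuous.tendsto (by fun_prop) y₀)
  simpa using this

theorem surjective_of_zero_mem_interior_image_sub {X W : Type*} [NormedAddCommGroup X]
    [NormedSpace ℝ X] [NormedAddCommGroup W] [NormedSpace ℝ W] {C : Set X} {x₀ : X}
    {E : X →L[ℝ] W} (h : (0 : W) ∈ interior ((fun c => E (c - x₀)) '' C)) :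
    Function.Surjective E := by
  intro w
  have h1 : Tendsto (fun t : ℝ => t • w) (𝓝[>] 0) (𝓝 0) := by
    have : Tendsto (fun t : ℝ => t • w) (𝓝 0) (𝓝 ((0 : ℝ) • w)) :=
      Continuous.tendsto (by fun_prop) 0
    rw [zero_smul] at this
    exact this.mono_left nhdsWithin_le_nhds
  obtain ⟨t, ⟨c, -, hc⟩, ht⟩ :=
    ((h1.eventually (mem_interior_iff_mem_nhds.1 h)).and self_mem_nhdsWithin).exists
  have ht : (0 : ℝ) < t := ht
  refine ⟨t⁻¹ • (c - x₀), ?_⟩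
  simp only at hc
  rw [map_smul, hc, smul_smul, inv_mul_cancel₀ ht.ne', one_smul]

/-- Coercivity on the kernel of a surjective operator extends to the whole space up to a penalty
on the image. -/
theorem exists_coercive_sub_penalty {X W : Type*} [NormedAddCommGroup X] [InnerProductSpace ℝ X]
    [CompleteSpace X] [NormedAddCommGroup W] [InnerProductSpace ℝ W] [CompleteSpace W]
    {E : X →L[ℝ] W} (hE : Function.Surjective E) (A : X →L[ℝ] X) {κ : ℝ} (hκ : 0 < κ)
    (hcoer : ∀ x : X, E x = 0 → κ * ‖x‖ ^ 2 ≤ ⟪A x, x⟫) :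
    ∃ M, 0 ≤ M ∧ ∀ x : X, κ / 2 * ‖x‖ ^ 2 - M * ‖E x‖ ^ 2 ≤ ⟪A x, x⟫ := by
  obtain ⟨c, hc, hpre⟩ := E.exists_preimage_norm_le hE
  have haux : 0 ≤ ‖A‖ + κ / 2 + (2 * ‖A‖ + κ) ^ 2 / (2 * κ) := by positivity
  refine ⟨(‖A‖ + κ / 2 + (2 * ‖A‖ + κ) ^ 2 / (2 * κ)) * c ^ 2, by positivity, fun x => ?_⟩
  obtain ⟨v, hv, hvn⟩ := hpre (E x)
  obtain ⟨y, rfl⟩ : ∃ y, x = y + v := ⟨x - v, by abel⟩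
  have hy : E y = 0 := by simpa using hv
  have h1 := hcoer y hy
  have hb : ∀ a b : X, -(‖A‖ * ‖a‖ * ‖b‖) ≤ ⟪A a, b⟫ := fun a b => by
    have := (abs_le.1 (abs_real_inner_le_norm (A a) b)).1
    have h2 := mul_le_mul_of_nonneg_right (A.le_opNorm a) (norm_nonneg b)
    linarith
  have e1 : ⟪A (y + v), y + v⟫ = ⟪A y, y⟫ + ⟪A y, v⟫ + ⟪A v, y⟫ + ⟪A v, v⟫ := by
    simp only [map_add, inner_add_left, inner_add_right]; ring
  have h3 : ‖y + v‖ ^ 2 ≤ (‖y‖ + ‖v‖) ^ 2 := by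
    gcongr; exact norm_add_le _ _
  have h4 : ‖v‖ ^ 2 ≤ c ^ 2 * ‖E (y + v)‖ ^ 2 := by
    rw [← mul_pow]; gcongr
  have h5 := hb y v
  have h6 := hb v y
  have h7 := hb v v
  have h8 := mul_le_mul_of_nonneg_left h4 haux
  have h9 : 0 ≤ κ / 2 * ‖y‖ ^ 2 - (2 * ‖A‖ + κ) * ‖y‖ * ‖v‖
      + (2 * ‖A‖ + κ) ^ 2 / (2 * κ) * ‖v‖ ^ 2 := by
    have : κ / 2 * ‖y‖ ^ 2 - (2 * ‖A‖ + κ) * ‖y‖ * ‖v‖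
      + (2 * ‖A‖ + κ) ^ 2 / (2 * κ) * ‖v‖ ^ 2
      = (κ * ‖y‖ - (2 * ‖A‖ + κ) * ‖v‖) ^ 2 / (2 * κ) := by
      field_simp; ring
    rw [this]; positivity
  have h10 := mul_le_mul_of_nonneg_left h3 (half_pos hκ).le
  rw [e1]
  nlinarith

theorem le_mul_of_mul_sq_le {α a b d m : ℝ} (hα : 0 < α) (ha : 0 ≤ a) (hb : 0 ≤ b)
    (hm : 0 ≤ m) (h : α * d ^ 2 ≤ a * b ^ 2 + m * b * d) : d ≤ ((a + m) / α + 1) * b := by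
  have h0 : 0 ≤ (a + m) / α * b := by positivity
  by_cases hdb : d ≤ b
  · linarith
  · push Not at hdb
    have hd' : 0 < d := hb.trans_lt hdb
    have h1 : α * d ≤ (a + m) * b := by
      have : (α * d) * d ≤ ((a + m) * b) * d := by
        nlinarith [mul_le_mul_of_nonneg_left hdb.le (mul_nonneg ha hb)]
      exact le_of_mul_le_mul_right this hd'
    have h2 : d ≤ (a + m) * b / α := by
      rw [le_div_iff₀ hα]; linarith
    have h3 : (a + m) * b / α = (a + m) / α * b := by ring
    linarith

/-- A variational inequality tested only on `C ∩ S` holds on all of `C` if the perturbed linear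
problems have solutions in `C ∩ S`. -/
theorem inner_nonneg_of_inter {X W : Type*} [NormedAddCommGroup X] [InnerProductSpace ℝ X]
    [CompleteSpace X] [NormedAddCommGroup W] [InnerProductSpace ℝ W] [CompleteSpace W]
    {C S : Set X} (hC : Convex ℝ C) {E : X →L[ℝ] W} {A : X →L[ℝ] X} {κ : ℝ} (hκ : 0 < κ)
    (hcoer : ∀ x : X, E x = 0 → κ * ‖x‖ ^ 2 ≤ ⟪A x, x⟫) {x g : X} {lam : W} (hxC : x ∈ C)
    (hx : ∀ c ∈ C ∩ S, 0 ≤ ⟪A x + adjoint E lam + g, c - x⟫)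
    (hz : ∀ᶠ w in 𝓝 (E x), ∃ z ∈ C ∩ S, ∃ η : W, E z = w ∧
      ∀ c ∈ C, 0 ≤ ⟪A z + adjoint E η + g, c - z⟫) :
    ∀ c ∈ C, 0 ≤ ⟪A x + adjoint E lam + g, c - x⟫ := by
  intro c hc
  set s := ⟪A x + adjoint E lam + g, c - x⟫ with hs
  set B := (‖A‖ * ‖c - x‖) ^ 2 / (4 * κ) with hB
  have hlim : Tendsto (fun t : ℝ => E x + t • E (c - x)) (𝓝[>] 0) (𝓝 (E x)) := by
    have : Tendsto (fun t : ℝ => E x + t • E (c - x)) (𝓝 0) (𝓝 (E x + (0 : ℝ) • E (c - x))) :=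
      Continuous.tendsto (by fun_prop) 0
    rw [zero_smul, add_zero] at this
    exact this.mono_left nhdsWithin_le_nhds
  have hev : ∀ᶠ t : ℝ in 𝓝[>] 0, -(B * t) ≤ s := by
    filter_upwards [hlim.eventually hz, Ioo_mem_nhdsGT (zero_lt_one' ℝ)] with t ht ht1
    obtain ⟨z, hzC, η, hEz, hzη⟩ := ht
    have hxt : x + t • (c - x) ∈ C := hC.add_smul_sub_mem hxC hc ⟨ht1.1.le, ht1.2.le⟩
    have h1 := hzη _ hxt
    have h2 := hx z hzC
    obtain ⟨u, hu⟩ : ∃ u, u = x + t • (c - x) - z := ⟨_, rfl⟩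
    have hEu : E u = 0 := by rw [hu, map_sub, map_add, map_smul, hEz, sub_self]
    have hzu : z = x + t • (c - x) - u := by rw [hu]; abel
    have h3 := hcoer u hEu
    have e1 : ⟪A z + adjoint E η + g, x + t • (c - x) - z⟫
        = ⟪A x + g, u⟫ + t * ⟪A (c - x), u⟫ - ⟪A u, u⟫ := by
      rw [← hu, hzu]
      simp only [inner_add_left, map_sub, map_add, map_smul, inner_sub_left, inner_smul_left,
        adjoint_inner_left, hEu, inner_zero_right]
      simp
      ring
    have e2 : ⟪A x + adjoint E lam + g, z - x⟫ = t * s - ⟪A x + g, u⟫ := by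
      have : z - x = t • (c - x) - u := by rw [hzu]; abel
      rw [this, inner_sub_right, inner_smul_right, ← hs]
      simp only [inner_add_left, adjoint_inner_left, hEu, inner_zero_right]
      ring
    have h4 : ⟪A (c - x), u⟫ ≤ ‖A‖ * ‖c - x‖ * ‖u‖ :=
      (real_inner_le_norm _ _).trans
        (mul_le_mul_of_nonneg_right (A.le_opNorm _) (norm_nonneg _))
    rw [e1] at h1
    rw [e2] at h2
    have h5 := mul_le_mul_of_nonneg_left h4 ht1.1.le
    have h6 : t * (‖A‖ * ‖c - x‖ * ‖u‖) - κ * ‖u‖ ^ 2 ≤ B * t ^ 2 := by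
      have : B * t ^ 2 - (t * (‖A‖ * ‖c - x‖ * ‖u‖) - κ * ‖u‖ ^ 2)
          = (‖A‖ * ‖c - x‖ * t - 2 * κ * ‖u‖) ^ 2 / (4 * κ) := by
        rw [hB]; field_simp; ring
      have h7 : 0 ≤ (‖A‖ * ‖c - x‖ * t - 2 * κ * ‖u‖) ^ 2 / (4 * κ) := by positivity
      linarith
    have h8 : t * (-(B * t)) ≤ t * s := by nlinarith
    exact le_of_mul_le_mul_left h8 ht1.1
  have hlim0 : Tendsto (fun t : ℝ => -(B * t)) (𝓝[>] 0) (𝓝 0) := by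
    have : Tendsto (fun t : ℝ => -(B * t)) (𝓝 0) (𝓝 (-(B * 0))) :=
      Continuous.tendsto (by fun_prop) 0
    simp only [mul_zero, neg_zero] at this
    exact this.mono_left nhdsWithin_le_nhds
  exact le_of_tendsto hlim0 hev

/-- Uniform contraction principle on a closed ball. -/
theorem exists_fixedPoint_family {Z Q : Type*} [MetricSpace Z] [CompleteSpace Z]
    [PseudoMetricSpace Q] {T : Q → Z → Z} {z₀ : Z} {r K : ℝ} (hr : 0 < r) {N : Set Q}
    (hT : ∀ q ∈ N, ∀ z ∈ Metric.closedBall z₀ r, ∀ z' ∈ Metric.closedBall z₀ r,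
      dist (T q z) (T q z') ≤ 1 / 2 * dist z z')
    (hT₀ : ∀ q ∈ N, dist (T q z₀) z₀ ≤ r / 2)
    (hTq : ∀ q ∈ N, ∀ q' ∈ N, ∀ z ∈ Metric.closedBall z₀ r,
      dist (T q z) (T q' z) ≤ K * dist q q') :
    ∃ φ : Q → Z, (∀ q ∈ N, φ q ∈ Metric.closedBall z₀ r ∧ T q (φ q) = φ q ∧
        ∀ z ∈ Metric.closedBall z₀ r, T q z = z → z = φ q) ∧
      ∀ q ∈ N, ∀ q' ∈ N, dist (φ q) (φ q') ≤ 2 * K * dist q q' := by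
  have hz₀ : z₀ ∈ Metric.closedBall z₀ r := Metric.mem_closedBall_self hr.le
  have hmaps : ∀ q ∈ N, Set.MapsTo (T q) (Metric.closedBall z₀ r) (Metric.closedBall z₀ r) := by
    intro q hq z hz
    have h1 := hT q hq z hz z₀ hz₀
    have h2 := hT₀ q hq
    have h3 := dist_triangle (T q z) (T q z₀) z₀
    rw [Metric.mem_closedBall] at hz ⊢
    linarith
  have hex : ∀ q, ∃ z, q ∈ N → z ∈ Metric.closedBall z₀ r ∧ T q z = z := by
    intro q
    by_cases hq : q ∈ N
    · have hcon : ContractingWith (1 / 2) ((hmaps q hq).restrict (T q) _ _) := by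
        refine ⟨by
          rw [← NNReal.coe_lt_coe]; norm_num, LipschitzWith.of_dist_le_mul fun a b => ?_⟩
        have := hT q hq a a.2 b b.2
        simpa [Subtype.dist_eq] using this
      obtain ⟨z, hz, hfix, -⟩ := hcon.exists_fixedPoint' Metric.isClosed_closedBall.isComplete
        (hmaps q hq) hz₀ (edist_ne_top _ _)
      exact ⟨z, fun _ => ⟨hz, hfix⟩⟩
    · exact ⟨z₀, fun h => absurd h hq⟩
  choose φ hφ using hex
  refine ⟨φ, fun q hq => ⟨(hφ q hq).1, (hφ q hq).2, fun z hz hzT => ?_⟩, fun q hq q' hq' => ?_⟩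
  · have h1 := hT q hq z hz _ (hφ q hq).1
    rw [hzT, (hφ q hq).2] at h1
    have h2 : dist z (φ q) = 0 := le_antisymm (by linarith) dist_nonneg
    exact dist_eq_zero.1 h2
  · have h1 := hT q hq _ (hφ q hq).1 _ (hφ q' hq').1
    have h2 := hTq q hq q' hq' _ (hφ q' hq').1
    have h3 := dist_triangle (T q (φ q)) (T q (φ q')) (T q' (φ q'))
    rw [(hφ q hq).2, (hφ q' hq').2] at h3
    rw [(hφ q hq).2] at h1
    rw [(hφ q' hq').2] at h2
    linarith

/-- Second-order sufficient condition: a first-order point whose Lagrangian gradient is close to a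
linear map that is coercive up to a penalty on the linearized constraint minimizes `f` locally. -/
theorem le_of_lagrangian_coercive {X W : Type*} [NormedAddCommGroup X] [InnerProductSpace ℝ X]
    [CompleteSpace X] [NormedAddCommGroup W] [InnerProductSpace ℝ W] [CompleteSpace W]
    {C B : Set X} (hB : Convex ℝ B) {f : X → ℝ} {f' : X → X}
    (hf : ∀ x ∈ B, HasGradientAt f (f' x) x) {e : X → W} {e' : X → (X →L[ℝ] W)}
    (he : ∀ x ∈ B, HasFDerivAt e (e' x) x) {lam : W} {A : X →L[ℝ] X} {E : X →L[ℝ] W}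
    {α M ε ε' : ℝ} (hM : 0 ≤ M)
    (hcoer : ∀ v, α * ‖v‖ ^ 2 - M * ‖E v‖ ^ 2 ≤ ⟪A v, v⟫) (hε : M * ε' ^ 2 + ε ≤ α)
    (hg : ∀ x ∈ B, ∀ y ∈ B, ‖(f' x + adjoint (e' x) lam) - (f' y + adjoint (e' y) lam)
      - A (x - y)‖ ≤ ε * ‖x - y‖)
    (hE : ∀ x ∈ B, ∀ y ∈ B, ‖e x - e y - E (x - y)‖ ≤ ε' * ‖x - y‖)
    {y : X} (hyB : y ∈ B) (hy : e y = 0)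
    (hVI : ∀ c ∈ C, 0 ≤ ⟪f' y + adjoint (e' y) lam, c - y⟫)
    {x : X} (hxB : x ∈ B) (hxC : x ∈ C) (hx : e x = 0) : f y ≤ f x := by
  obtain ⟨v, rfl⟩ : ∃ v, x = y + v := ⟨x - y, by abel⟩
  have hEv : ‖E v‖ ≤ ε' * ‖v‖ := by
    have := hE _ hxB _ hyB
    rwa [hx, hy, sub_zero, zero_sub, norm_neg, add_sub_cancel_left] at this
  have hAv : ε * ‖v‖ ^ 2 ≤ ⟪A v, v⟫ := by
    have h1 : ‖E v‖ ^ 2 ≤ (ε' * ‖v‖) ^ 2 := by gcongr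
    have h2 := mul_le_mul_of_nonneg_left h1 hM
    have h3 := hcoer v
    have h4 := mul_le_mul_of_nonneg_right hε (sq_nonneg ‖v‖)
    nlinarith
  have hseg : ∀ t ∈ Set.Icc (0 : ℝ) 1, y + t • v ∈ B := fun t ht => by
    have := hB.add_smul_sub_mem hyB hxB ht
    rwa [add_sub_cancel_left] at this
  have hder : ∀ t ∈ Set.Icc (0 : ℝ) 1,
      HasDerivAt (fun t : ℝ => f (y + t • v) + ⟪lam, e (y + t • v)⟫)
        ⟪f' (y + t • v) + adjoint (e' (y + t • v)) lam, v⟫ t := fun t ht => by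
    have hl : HasDerivAt (fun t : ℝ => y + t • v) v t := by
      simpa using ((hasDerivAt_id t).smul_const v).const_add y
    have h1 := (hf _ (hseg t ht)).hasFDerivAt.comp_hasDerivAt t hl
    have h2 := (he _ (hseg t ht)).comp_hasDerivAt t hl
    have h3 := h1.add ((hasDerivAt_const t lam).inner ℝ h2)
    refine h3.congr_deriv ?_
    simp [inner_add_left, adjoint_inner_left]
  have hmono : MonotoneOn (fun t : ℝ => f (y + t • v) + ⟪lam, e (y + t • v)⟫)
      (Set.Icc (0 : ℝ) 1) := by
    refine monotoneOn_of_deriv_nonneg (convex_Icc 0 1)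
      (fun t ht => (hder t ht).continuousAt.continuousWithinAt)
      (fun t ht => (hder t (interior_subset ht)).differentiableAt.differentiableWithinAt)
      (fun t ht => ?_)
    have ht := interior_subset ht
    rw [(hder t ht).deriv]
    have h1 := hg _ (hseg t ht) _ hyB
    rw [add_sub_cancel_left, norm_smul, Real.norm_of_nonneg ht.1] at h1
    set R := (f' (y + t • v) + adjoint (e' (y + t • v)) lam) - (f' y + adjoint (e' y) lam)
      - A (t • v) with hR
    have h2 : f' (y + t • v) + adjoint (e' (y + t • v)) lam
        = (f' y + adjoint (e' y) lam) + t • A v + R := by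
      rw [hR, map_smul]; abel
    have h3 := hVI _ hxC
    rw [add_sub_cancel_left] at h3
    have h4 := (abs_le.1 (abs_real_inner_le_norm R v)).1
    have h5 := mul_le_mul_of_nonneg_right h1 (norm_nonneg v)
    have h6 := mul_le_mul_of_nonneg_left hAv ht.1
    rw [h2, inner_add_left, inner_add_left (f' y + adjoint (e' y) lam), real_inner_smul_left]
    nlinarith
  have := hmono (Set.left_mem_Icc.2 zero_le_one) (Set.right_mem_Icc.2 zero_le_one) zero_le_one
  simpa [hx, hy] using this

/-- The gradient of the Lagrangian is strictly differentiable in `x`, uniformly in the parameter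
and the multiplier. -/
theorem exists_forall_lagrangian_gradient_le {X W P : Type*} [NormedAddCommGroup X]
    [InnerProductSpace ℝ X] [CompleteSpace X] [NormedAddCommGroup W] [InnerProductSpace ℝ W]
    [CompleteSpace W] [PseudoMetricSpace P] {f : X → ℝ} {f' : X → X} {x₀ : X} {q₀ : P} {lam₀ : W}
    (hfC2 : ContDiffAt ℝ 2 f x₀) (hf' : ∀ᶠ x in 𝓝 x₀, HasGradientAt f (f' x) x)
    {e' : X → P → (X →L[ℝ] W)} {e'' : X → P → (X →L[ℝ] X →L[ℝ] W)}
    (he'' : ∀ᶠ p : X × P in 𝓝 (x₀, q₀), HasFDerivAt (fun y => e' y p.2) (e'' p.1 p.2) p.1)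
    (he''c : ContinuousAt (fun p : X × P => e'' p.1 p.2) (x₀, q₀))
    {A : X →L[ℝ] X} (hA : HasFDerivAt (fun x => f' x + (adjoint (e' x q₀)) lam₀) A x₀)
    {ε : ℝ} (hε : 0 < ε) :
    ∃ δ > 0, ∀ q ∈ Metric.ball q₀ δ, ∀ lam ∈ Metric.ball lam₀ δ, ∀ x ∈ Metric.ball x₀ δ,
      ∀ y ∈ Metric.ball x₀ δ,
      ‖(f' x + adjoint (e' x q) lam) - (f' y + adjoint (e' y q) lam) - A (x - y)‖
        ≤ ε * ‖x - y‖ := by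
  obtain ⟨F, hF⟩ : ∃ F : X →L[ℝ] X, HasStrictFDerivAt f' F x₀ := by
    have h1 : ContDiffAt ℝ 1 (fderiv ℝ f) x₀ := hfC2.fderiv_right (by norm_num)
    have h2 := h1.hasStrictFDerivAt one_ne_zero
    obtain ⟨J, hJ⟩ : ∃ J : StrongDual ℝ X →L[ℝ] X,
        ∀ y, J y = (InnerProductSpace.toDual ℝ X).symm y :=
      ⟨LinearMap.mkContinuous
        { toFun := (InnerProductSpace.toDual ℝ X).symm
          map_add' := map_add _
          map_smul' := fun c y => by simp } 1 (fun y => by simp), fun _ => rfl⟩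
    refine ⟨_, (J.hasStrictFDerivAt.comp x₀ h2).congr_of_eventuallyEq ?_⟩
    filter_upwards [hf'] with x hx
    simp [hJ, hx.hasFDerivAt.fderiv]
  have hAeq : ∀ v, A v = F v + adjoint (e'' x₀ q₀ v) lam₀ := by
    intro v
    have h1 : HasFDerivAt (fun y => e' y q₀) (e'' x₀ q₀) x₀ := he''.self_of_nhds
    have h2 : HasDerivAt (fun t : ℝ => x₀ + t • v) v 0 := by
      simpa using ((hasDerivAt_id (0 : ℝ)).smul_const v).const_add x₀
    have h0 : x₀ + (0 : ℝ) • v = x₀ := by simp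
    have h3 : HasDerivAt (fun t : ℝ => e' (x₀ + t • v) q₀) (e'' x₀ q₀ v) 0 :=
      HasFDerivAt.comp_hasDerivAt (0 : ℝ) (l := fun x => e' x q₀) (by simpa using h1) h2
    have h4 : HasDerivAt (fun t : ℝ => f' (x₀ + t • v)) (F v) 0 :=
      HasFDerivAt.comp_hasDerivAt (0 : ℝ) (by simpa using hF.hasFDerivAt) h2
    have h5 := HasFDerivAt.comp_hasDerivAt (0 : ℝ) (l := fun x => f' x + (adjoint (e' x q₀)) lam₀)
      (by simpa using hA) h2
    refine ext_inner_right ℝ fun w => ?_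
    have h6 := h5.inner ℝ (hasDerivAt_const (0 : ℝ) w)
    have h7 := (h4.inner ℝ (hasDerivAt_const (0 : ℝ) w)).add
      ((hasDerivAt_const (0 : ℝ) lam₀).inner ℝ (h3.clm_apply (hasDerivAt_const (0 : ℝ) w)))
    have h8 := h6.unique (h7.congr_of_eventuallyEq (Eventually.of_forall fun t => by
      simp [inner_add_left, adjoint_inner_left]))
    simpa [inner_add_left, adjoint_inner_left] using h8
  set a := ‖lam₀‖ + 1 with ha
  have ha0 : 0 < a := by positivity
  set b := ‖e'' x₀ q₀‖ + 1 with hb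
  have hb0 : 0 < b := by positivity
  obtain ⟨δ₁, hδ₁, h₁⟩ := exists_forall_norm_sub_sub_le he'' he''c
    (ε := ε / (3 * a)) (by positivity)
  obtain ⟨δ₂, hδ₂, h₂⟩ : ∃ δ > 0, ∀ x ∈ Metric.ball x₀ δ, ∀ y ∈ Metric.ball x₀ δ,
      ‖f' x - f' y - F (x - y)‖ ≤ ε / 3 * ‖x - y‖ := by
    obtain ⟨δ, hδ, h⟩ := Metric.eventually_nhds_iff.1
      (hF.isLittleO.def (show 0 < ε / 3 by positivity))
    exact ⟨δ, hδ, fun x hx y hy => h (y := (x, y)) (max_lt hx hy)⟩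
  refine ⟨min (min δ₁ δ₂) (min 1 (ε / (3 * b))), by positivity,
    fun q hq lam hlam x hx y hy => ?_⟩
  rw [Metric.mem_ball, lt_min_iff, lt_min_iff, lt_min_iff] at hq hlam hx hy
  have k1 := h₁ q hq.1.1 x hx.1.1 y hy.1.1
  have k2 := h₂ x hx.1.2 y hy.1.2
  set D := e' x q - e' y q - e'' x₀ q₀ (x - y) with hD
  have e1 : (f' x + adjoint (e' x q) lam) - (f' y + adjoint (e' y q) lam) - A (x - y)
      = (f' x - f' y - F (x - y)) + adjoint D lam
        + adjoint (e'' x₀ q₀ (x - y)) (lam - lam₀) := by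
    rw [hAeq, hD]
    simp only [map_sub, _root_.sub_apply]
    abel
  have hlam1 : ‖lam‖ ≤ a := by
    have := norm_sub_norm_le lam lam₀
    rw [← dist_eq_norm] at this
    linarith [hlam.2.1]
  have hlam2 : ‖lam - lam₀‖ ≤ ε / (3 * b) := by
    rw [← dist_eq_norm]; exact hlam.2.2.le
  have n1 : ‖adjoint D lam‖ ≤ ε / 3 * ‖x - y‖ := by
    calc ‖adjoint D lam‖ ≤ ‖adjoint D‖ * ‖lam‖ := le_opNorm _ _
      _ = ‖D‖ * ‖lam‖ := by rw [LinearIsometryEquiv.norm_map]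
      _ ≤ (ε / (3 * a) * ‖x - y‖) * a := by gcongr
      _ = ε / 3 * ‖x - y‖ := by field_simp
  have n2 : ‖adjoint (e'' x₀ q₀ (x - y)) (lam - lam₀)‖ ≤ ε / 3 * ‖x - y‖ := by
    calc ‖adjoint (e'' x₀ q₀ (x - y)) (lam - lam₀)‖
        ≤ ‖adjoint (e'' x₀ q₀ (x - y))‖ * ‖lam - lam₀‖ := le_opNorm _ _
      _ = ‖e'' x₀ q₀ (x - y)‖ * ‖lam - lam₀‖ := by rw [LinearIsometryEquiv.norm_map]
      _ ≤ (b * ‖x - y‖) * (ε / (3 * b)) := by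
        gcongr
        refine (le_opNorm _ _).trans ?_
        gcongr
        linarith
      _ = ε / 3 * ‖x - y‖ := by field_simp
  rw [e1]
  calc _ ≤ ‖f' x - f' y - F (x - y)‖ + ‖adjoint D lam‖
        + ‖adjoint (e'' x₀ q₀ (x - y)) (lam - lam₀)‖ := norm_add₃_le
    _ ≤ ε * ‖x - y‖ := by linarith

/-- Joint strict differentiability in `(x, l)` at a base point of `u x + B x q l`, uniformly in
the parameter. -/
theorem exists_forall_affine_remainder_le {X L P Z : Type*} [NormedAddCommGroup X]
    [NormedSpace ℝ X] [NormedAddCommGroup L] [NormedSpace ℝ L] [NormedAddCommGroup P]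
    [NormedAddCommGroup Z] [NormedSpace ℝ Z] {u : X → Z} {B : X → P → (L →L[ℝ] Z)}
    {G' : X → P → L → (X →L[ℝ] Z)} {x₀ : X} {q₀ : P} {l₀ : L}
    {U₁ : Set X} (hU₁ : U₁ ∈ 𝓝 x₀) {U₂ : Set P} (hU₂ : U₂ ∈ 𝓝 q₀)
    (hG : ∀ x ∈ U₁, ∀ q ∈ U₂, ∀ l, HasFDerivAt (fun z => u z + B z q l) (G' x q l) x)
    (hc : ContinuousAt (fun t : X × P × L => G' t.1 t.2.1 t.2.2) (x₀, q₀, l₀))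
    {ν : ℝ} (hν : 0 < ν)
    (hB : ∀ x ∈ U₁, ∀ q₁ ∈ U₂, ∀ q₂ ∈ U₂, ‖B x q₁ - B x q₂‖ ≤ ν * ‖q₁ - q₂‖)
    {ε : ℝ} (hε : 0 < ε) :
    ∃ δ > 0, ∀ q ∈ Metric.ball q₀ δ, ∀ x ∈ Metric.ball x₀ δ, ∀ x' ∈ Metric.ball x₀ δ,
      ∀ l ∈ Metric.ball l₀ δ, ∀ l' : L,
      ‖G' x₀ q₀ l₀ (x - x') + B x₀ q₀ (l - l') - ((u x + B x q l) - (u x' + B x' q l'))‖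
        ≤ ε * (‖x - x'‖ + ‖l - l'‖) := by
  have hG' : ∀ᶠ p : X × P × L in 𝓝 (x₀, q₀, l₀),
      HasFDerivAt (fun y => u y + B y p.2.1 p.2.2) (G' p.1 p.2.1 p.2.2) p.1 := by
    filter_upwards [prod_mem_nhds hU₁ (prod_mem_nhds hU₂ univ_mem)] with p hp
    exact hG _ hp.1 _ hp.2.1 _
  obtain ⟨δ₁, hδ₁, h₁⟩ := exists_forall_norm_sub_sub_le (Q := P × L)
    (F := fun y p => u y + B y p.1 p.2) (F' := fun y p => G' y p.1 p.2) hG' hc hε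
  obtain ⟨ρ₁, hρ₁, hρU₁⟩ := Metric.mem_nhds_iff.1 hU₁
  obtain ⟨ρ₂, hρ₂, hρU₂⟩ := Metric.mem_nhds_iff.1 hU₂
  have hBx : ∀ q ∈ Metric.ball q₀ δ₁, ∀ x ∈ Metric.ball x₀ δ₁, ∀ x' ∈ Metric.ball x₀ δ₁,
      ‖B x q - B x' q‖ ≤ 4 * ε / δ₁ * ‖x - x'‖ := by
    intro q hq x hx x' hx'
    refine opNorm_le_of_unit_norm (by positivity) fun m hm => ?_
    have hdist : dist (l₀ + (δ₁ / 2) • m) l₀ < δ₁ := by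
      rw [dist_self_add_left, norm_smul, hm, mul_one, Real.norm_of_nonneg (by positivity)]
      linarith
    have k1 := h₁ (q, l₀ + (δ₁ / 2) • m) (max_lt hq hdist) x hx x' hx'
    have hdist₀ : dist l₀ l₀ < δ₁ := by rwa [dist_self]
    have k2 := h₁ (q, l₀) (max_lt hq hdist₀) x hx x' hx'
    have k3 : (δ₁ / 2) • (B x q - B x' q) m
        = (u x + B x q (l₀ + (δ₁ / 2) • m) - (u x' + B x' q (l₀ + (δ₁ / 2) • m))
          - G' x₀ q₀ l₀ (x - x'))
        - (u x + B x q l₀ - (u x' + B x' q l₀) - G' x₀ q₀ l₀ (x - x')) := by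
      simp only [map_add, map_smul, _root_.sub_apply, smul_sub]
      abel
    have k4 : δ₁ / 2 * ‖(B x q - B x' q) m‖ ≤ 2 * ε * ‖x - x'‖ := by
      rw [← Real.norm_of_nonneg (show 0 ≤ δ₁ / 2 by positivity), ← norm_smul, k3]
      refine (norm_sub_le _ _).trans ?_
      linarith
    rw [div_mul_eq_mul_div, le_div_iff₀ hδ₁]
    linarith
  refine ⟨min (min δ₁ (min ρ₁ ρ₂)) (min (δ₁ / 8) (ε / (2 * ν))), by positivity,
    fun q hq x hx x' hx' l hl l' => ?_⟩
  rw [Metric.mem_ball, lt_min_iff, lt_min_iff, lt_min_iff, lt_min_iff] at hq hx hx' hl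
  have k1 := h₁ (q, l) (max_lt hq.1.1 hl.1.1) x hx.1.1 x' hx'.1.1
  have hx₀ : x₀ ∈ Metric.ball x₀ δ₁ := Metric.mem_ball_self hδ₁
  have hq₀ : q₀ ∈ Metric.ball q₀ δ₁ := Metric.mem_ball_self hδ₁
  have k2 : ‖B x' q - B x₀ q₀‖ ≤ ε := by
    have j1 := hBx q₀ hq₀ x' hx'.1.1 x₀ hx₀
    have j2 := hB x' (hρU₁ hx'.1.2.1) q (hρU₂ hq.1.2.2) q₀ (mem_of_mem_nhds hU₂)
    rw [← dist_eq_norm x'] at j1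
    rw [← dist_eq_norm q] at j2
    have j3 : 4 * ε / δ₁ * dist x' x₀ ≤ ε / 2 := by
      calc 4 * ε / δ₁ * dist x' x₀ ≤ 4 * ε / δ₁ * (δ₁ / 8) := by gcongr; exact hx'.2.1.le
        _ = ε / 2 := by field_simp; norm_num
    have j4 : ν * dist q q₀ ≤ ε / 2 := by
      calc ν * dist q q₀ ≤ ν * (ε / (2 * ν)) := by gcongr; exact hq.2.2.le
        _ = ε / 2 := by field_simp
    have j5 := norm_add_le (B x' q - B x' q₀) (B x' q₀ - B x₀ q₀)
    rw [sub_add_sub_cancel] at j5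
    linarith
  have k3 : G' x₀ q₀ l₀ (x - x') + B x₀ q₀ (l - l') - ((u x + B x q l) - (u x' + B x' q l'))
      = -((u x + B x q l) - (u x' + B x' q l) - G' x₀ q₀ l₀ (x - x'))
        - (B x' q - B x₀ q₀) (l - l') := by
    simp only [map_sub, _root_.sub_apply]
    abel
  rw [k3]
  refine (norm_sub_le _ _).trans ?_
  rw [norm_neg, mul_add]
  exact add_le_add k1 ((le_opNorm _ _).trans (by gcongr))

/-- Two-norm Lipschitz estimates for the solutions of linear variational inequalities yield a
Lipschitz estimate in the strong norm. -/
theorem exists_norm_sub_le_of_two_norm_estimate {X W Xu Wu Xu' : Type*} [NormedAddCommGroup X]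
    [InnerProductSpace ℝ X] [CompleteSpace X] [NormedAddCommGroup W] [InnerProductSpace ℝ W]
    [CompleteSpace W] [NormedAddCommGroup Xu] [NormedSpace ℝ Xu]
    [NormedAddCommGroup Wu] [NormedSpace ℝ Wu] [NormedAddCommGroup Xu'] [NormedSpace ℝ Xu']
    {ιX : Xu →L[ℝ] X} {ιW : Wu →L[ℝ] W} {ιX' : Xu' →L[ℝ] X} {C : Set X}
    {A : X →L[ℝ] X} {E : X →L[ℝ] W} {α M : ℝ} (hα : 0 < α) (hM : 0 ≤ M)
    (hcoer : ∀ v, α * ‖v‖ ^ 2 - M * ‖E v‖ ^ 2 ≤ ⟪A v, v⟫) {a b x₀ : X}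
    {V : Set (Xu' × W)} {sol : Xu' × W → Xu × Wu}
    (hsol : ∀ β ∈ V,
      (∀ c ∈ C, 0 ≤ ⟪A (ιX (sol β).1) + adjoint E (ιW (sol β).2) + a - b - ιX' β.1,
        c - ιX (sol β).1⟫) ∧ ιX (sol β).1 ∈ C ∧ E (ιX (sol β).1) - E x₀ = β.2)
    {k : ℝ} (hk : 0 < k)
    (hLip : ∀ β ∈ V, ∀ β' ∈ V,
      ‖(sol β).1 - (sol β').1‖ + ‖(sol β).2 - (sol β').2‖ ≤
        k * (‖β - β'‖ + ‖ιX (sol β).1 - ιX (sol β').1‖)) :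
    ∃ K > 0, ∀ β ∈ V, ∀ β' ∈ V, ‖sol β - sol β'‖ ≤ K * ‖β - β'‖ := by
  set c := ((M + ‖ιW‖ * k) + (‖ιW‖ * k + ‖ιX'‖)) / α + 1 with hc
  have hc0 : 0 < c := by positivity
  refine ⟨k * (1 + c), by positivity, fun β hβ β' hβ' => ?_⟩
  obtain ⟨v, hv⟩ : ∃ v, v = ιX (sol β).1 - ιX (sol β').1 := ⟨_, rfl⟩
  have h1 := (hsol β hβ).1 _ (hsol β' hβ').2.1
  have h2 := (hsol β' hβ').1 _ (hsol β hβ).2.1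
  have hL := hLip β hβ β' hβ'
  rw [← hv] at hL h2
  rw [← neg_sub (ιX (sol β).1), ← hv] at h1
  have hEv : E v = β.2 - β'.2 := by
    rw [hv, map_sub, ← (hsol β hβ).2.2, ← (hsol β' hβ').2.2]; abel
  have h3 : ⟪A v, v⟫ ≤ ⟪ιX' (β.1 - β'.1), v⟫ - ⟪ιW ((sol β).2 - (sol β').2), E v⟫ := by
    have e1 : A v = A (ιX (sol β).1) - A (ιX (sol β').1) := by rw [hv, map_sub]
    rw [e1]
    simp only [inner_neg_right, inner_add_left, inner_sub_left, adjoint_inner_left, map_sub]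
      at h1 h2 ⊢
    linarith
  have hb1 : ‖β.1 - β'.1‖ ≤ ‖β - β'‖ := norm_fst_le (β - β')
  have hb2 : ‖E v‖ ≤ ‖β - β'‖ := hEv ▸ norm_snd_le (β - β')
  have h4 : ⟪ιX' (β.1 - β'.1), v⟫ ≤ ‖ιX'‖ * ‖β - β'‖ * ‖v‖ :=
    (real_inner_le_norm _ _).trans (by gcongr; exact (le_opNorm _ _).trans (by gcongr))
  have h5 : ‖(sol β).2 - (sol β').2‖ ≤ k * (‖β - β'‖ + ‖v‖) := by
    linarith [norm_nonneg ((sol β).1 - (sol β').1)]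
  have h6 : -(‖ιW‖ * (k * (‖β - β'‖ + ‖v‖)) * ‖β - β'‖)
      ≤ ⟪ιW ((sol β).2 - (sol β').2), E v⟫ := by
    refine le_trans (neg_le_neg ?_) (abs_le.1 (abs_real_inner_le_norm _ _)).1
    gcongr
    exact (le_opNorm _ _).trans (by gcongr)
  have h7 : M * ‖E v‖ ^ 2 ≤ M * ‖β - β'‖ ^ 2 := by gcongr
  have h8 : ‖v‖ ≤ c * ‖β - β'‖ := by
    refine le_mul_of_mul_sq_le hα (by positivity) (norm_nonneg _) (by positivity) ?_
    have := hcoer v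
    linarith
  have h9 : ‖sol β - sol β'‖ ≤ k * (‖β - β'‖ + ‖v‖) := by
    refine le_trans (max_le ?_ ?_) hL
    · exact le_add_of_nonneg_right (norm_nonneg _)
    · exact le_add_of_nonneg_left (norm_nonneg _)
  refine h9.trans ?_
  rw [mul_assoc]
  gcongr
  linarith

/-- Theorem 2.1 of the paper. Lipschitz stability for the abstract
parametric optimization problem `(P_q): min f(x) s.t. e(x,q) = 0, x ∈ C`, under the
assumptions (H0)–(H4).

Spaces: `X, W` real Hilbert spaces (duals identified via Riesz), `P` a normed space,
`Xu, Wu, Xu'` Banach spaces continuously embedded in `X, W, X` via the injective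
continuous linear maps `ιX, ιW, ιX'` (`Xu'` plays the role of `X̲* ⊆ X*`).

Derivative data: `f'` is the gradient of `f`; `ex' x q` is the `x`-derivative of
`e(·,q)` and `ex'' x q` its second derivative; `A` is the operator representing the
second `x`-derivative of the Lagrangian `L(x,q,λ) = f(x) + ⟨λ, e(x,q)⟩` at
`(x₀, q₀, lam₀)`, i.e. the derivative of `x ↦ f'(x) + e_x'(x,q₀)* lam₀` at `x₀`; `E` is
`ex' x₀ q₀`.  `fud` and `eadj` are the restrictions of `f'` and of
`(x,q) ↦ e_x'(x,q)*|_{W̲}` to the small spaces (H00), `Lu''` is the `x`-derivative of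
the restricted Lagrangian gradient `L̲'(x,q,λ) = f̲'(x) + e_x'(x,q)* λ` (H000).

Conclusion: there are neighborhoods `U ⊆ Xu × Wu` of `(x₀u, lam₀u)` and `N ⊆ P` of `q₀`,
a constant `μ > 0` and a map `q ↦ (x(q), λ(q))` such that for `q ∈ N` the pair
`(x(q), λ(q))` is the unique point of `U` satisfying the first-order optimality system,
the map is `μ`-Lipschitz from `N` into `Xu × Wu`, and on a nontrivial neighborhood
`Ñ ⊆ N` of `q₀` the point `x(q)` is a local solution of `(P_q)`. -/
theorem stmt_2
    {X W : Type*} [NormedAddCommGroup X] [InnerProductSpace ℝ X] [CompleteSpace X]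
    [NormedAddCommGroup W] [InnerProductSpace ℝ W] [CompleteSpace W]
    {P : Type*} [NormedAddCommGroup P] [NormedSpace ℝ P]
    {Xu Wu Xu' : Type*}
    [NormedAddCommGroup Xu] [NormedSpace ℝ Xu] [CompleteSpace Xu]
    [NormedAddCommGroup Wu] [NormedSpace ℝ Wu] [CompleteSpace Wu]
    [NormedAddCommGroup Xu'] [NormedSpace ℝ Xu'] [CompleteSpace Xu']
    -- continuous embeddings of the small spaces
    (ιX : Xu →L[ℝ] X) (hιX : Function.Injective ιX)
    (ιW : Wu →L[ℝ] W) (hιW : Function.Injective ιW)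
    (ιX' : Xu' →L[ℝ] X) (hιX' : Function.Injective ιX')
    -- the constraint set and the cost
    (C : Set X) (hCne : C.Nonempty) (hCcl : IsClosed C) (hCcv : Convex ℝ C)
    (f : X → ℝ) (hfnonneg : ∀ x, 0 ≤ f x)
    (e : X → P → W)
    -- nominal parameter and local solution
    (q₀ : P) (x₀ : X) (hx₀C : x₀ ∈ C) (hx₀e : e x₀ q₀ = 0)
    (hx₀loc : ∃ ε > (0 : ℝ), ∀ x ∈ C, e x q₀ = 0 → ‖x - x₀‖ < ε → f x₀ ≤ f x)
    -- (H0): regularity of f and e, with derivative data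
    (hfC2 : ∀ᶠ x in 𝓝 x₀, ContDiffAt ℝ 2 f x)
    (f' : X → X) (hf' : ∀ᶠ x in 𝓝 x₀, HasGradientAt f (f' x) x)
    (he_cont : Continuous fun p : X × P => e p.1 p.2)
    (ex' : X → P → (X →L[ℝ] W))
    (hex' : ∀ᶠ p : X × P in 𝓝 (x₀, q₀), HasFDerivAt (fun y => e y p.2) (ex' p.1 p.2) p.1)
    (ex'' : X → P → (X →L[ℝ] X →L[ℝ] W))
    (hex'' : ∀ᶠ p : X × P in 𝓝 (x₀, q₀),
      HasFDerivAt (fun y => ex' y p.2) (ex'' p.1 p.2) p.1)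
    (Lip : ℝ)
    (hLip : ∃ U ∈ 𝓝 ((x₀, q₀) : X × P), ∀ p ∈ U, ∀ p' ∈ U,
      ‖ex' p.1 p.2 - ex' p'.1 p'.2‖ ≤ Lip * ‖p - p'‖ ∧
      ‖ex'' p.1 p.2 - ex'' p'.1 p'.2‖ ≤ Lip * ‖p - p'‖)
    -- (H1): regular point condition and the Lagrange multiplier it provides
    (hreg : (0 : W) ∈ interior ((fun c => ex' x₀ q₀ (c - x₀)) '' C))
    (lam₀ : W)
    (hlam₀ : ∀ c ∈ C, 0 ≤ ⟪f' x₀ + (adjoint (ex' x₀ q₀)) lam₀, c - x₀⟫)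
    -- A = L''(x₀,q₀,lam₀) as a self-adjoint operator on X, E = e'(x₀,q₀)
    (A : X →L[ℝ] X) (hAsa : IsSelfAdjoint A)
    (hA : HasFDerivAt (fun x => f' x + (adjoint (ex' x q₀)) lam₀) A x₀)
    -- (H2): positive definiteness on ker E
    (κ : ℝ) (hκ : 0 < κ)
    (hcoer : ∀ x : X, ex' x₀ q₀ x = 0 → κ * ‖x‖ ^ 2 ≤ ⟪A x, x⟫)
    -- (x₀, lam₀) belongs to the small spaces
    (x₀u : Xu) (hx₀u : ιX x₀u = x₀) (lam₀u : Wu) (hlam₀u : ιW lam₀u = lam₀)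
    -- (H00): restrictions to the small spaces on a neighborhood Ũ₁ × Ũ₂
    (U1 : Set Xu) (hU1 : U1 ∈ 𝓝 x₀u) (U2 : Set P) (hU2 : U2 ∈ 𝓝 q₀)
    (fud : Xu → Xu') (hfud : ∀ xu ∈ U1, ιX' (fud xu) = f' (ιX xu))
    (eadj : Xu → P → (Wu →L[ℝ] Xu'))
    (headj : ∀ xu ∈ U1, ∀ q ∈ U2, ∀ lamu : Wu,
      ιX' (eadj xu q lamu) = (adjoint (ex' (ιX xu) q)) (ιW lamu))
    -- (H000): differentiability of the restricted Lagrangian gradient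
    (Lu'' : Xu → P → Wu → (Xu →L[ℝ] Xu'))
    (hLu'' : ∀ xu ∈ U1, ∀ q ∈ U2, ∀ lamu : Wu,
      HasFDerivAt (fun z : Xu => fud z + eadj z q lamu) (Lu'' xu q lamu) xu)
    (hLu''cont : ContinuousAt (fun t : Xu × P × Wu => Lu'' t.1 t.2.1 t.2.2)
      (x₀u, q₀, lam₀u))
    -- (H3): Lipschitz continuity in the parameter
    (ν : ℝ) (hν : 0 < ν)
    (hH3a : ∀ xu ∈ U1, ∀ q₁ ∈ U2, ∀ q₂ ∈ U2,
      ‖e (ιX xu) q₁ - e (ιX xu) q₂‖ ≤ ν * ‖q₁ - q₂‖)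
    (hH3b : ∀ xu ∈ U1, ∀ q₁ ∈ U2, ∀ q₂ ∈ U2,
      ‖eadj xu q₁ - eadj xu q₂‖ ≤ ν * ‖q₁ - q₂‖)
    -- (H4): solutions of the linearized generalized equation lie in the small
    -- spaces and satisfy the two-norm Lipschitz estimate
    (Vh : Set (Xu' × W)) (hVh : Vh ∈ 𝓝 ((0, 0) : Xu' × W))
    (sol : Xu' × W → Xu × Wu)
    (hsolGE : ∀ β ∈ Vh,
      (∀ c ∈ C, 0 ≤ ⟪A (ιX (sol β).1) + (adjoint (ex' x₀ q₀)) (ιW (sol β).2) +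
          f' x₀ - A x₀ - ιX' β.1, c - ιX (sol β).1⟫) ∧
      ιX (sol β).1 ∈ C ∧
      ex' x₀ q₀ (ιX (sol β).1) - ex' x₀ q₀ x₀ = β.2)
    (hsolu : ∀ β ∈ Vh, ∀ x : X, ∀ lam : W,
      x ∈ C →
      (∀ c ∈ C, 0 ≤ ⟪A x + (adjoint (ex' x₀ q₀)) lam + f' x₀ - A x₀ - ιX' β.1, c - x⟫) →
      ex' x₀ q₀ x - ex' x₀ q₀ x₀ = β.2 →
      x = ιX (sol β).1 ∧ lam = ιW (sol β).2)
    (k : ℝ) (hkpos : 0 < k)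
    (hsolLip : ∀ β ∈ Vh, ∀ β' ∈ Vh,
      ‖(sol β).1 - (sol β').1‖ + ‖(sol β).2 - (sol β').2‖ ≤
        k * (‖β - β'‖ + ‖ιX (sol β).1 - ιX (sol β').1‖)) :
    ∃ (U : Set (Xu × Wu)) (N : Set P) (μ : ℝ) (xl : P → Xu × Wu),
      U ∈ 𝓝 (x₀u, lam₀u) ∧ N ∈ 𝓝 q₀ ∧ 0 < μ ∧
      -- (i) existence and uniqueness in U of solutions of the first-order system
      (∀ q ∈ N,
        xl q ∈ U ∧
        ιX (xl q).1 ∈ C ∧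
        (∀ c ∈ C ∩ Set.range ιX,
          0 ≤ ⟪ιX' (fud (xl q).1 + eadj (xl q).1 q (xl q).2), c - ιX (xl q).1⟫) ∧
        e (ιX (xl q).1) q = 0 ∧
        (∀ p ∈ U, ιX p.1 ∈ C →
          (∀ c ∈ C ∩ Set.range ιX,
            0 ≤ ⟪ιX' (fud p.1 + eadj p.1 q p.2), c - ιX p.1⟫) →
          e (ιX p.1) q = 0 → p = xl q)) ∧
      -- (ii) Lipschitz dependence on the parameter
      (∀ q₁ ∈ N, ∀ q₂ ∈ N,
        ‖(xl q₁).1 - (xl q₂).1‖ + ‖(xl q₁).2 - (xl q₂).2‖ ≤ μ * ‖q₁ - q₂‖) ∧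
      -- (iii) local optimality on a nontrivial neighborhood Ñ ⊆ N of q₀
      (∃ Nt ∈ 𝓝 q₀, Nt ⊆ N ∧ ∀ q ∈ Nt, ∃ ε > (0 : ℝ),
        ∀ x ∈ C, e x q = 0 → ‖x - ιX (xl q).1‖ < ε → f (ιX (xl q).1) ≤ f x) := by
  have hEs : Function.Surjective (ex' x₀ q₀) := surjective_of_zero_mem_interior_image_sub hreg
  obtain ⟨M, hM, hco⟩ := exists_coercive_sub_penalty hEs A hκ hcoer
  obtain ⟨UL, hUL, hULip⟩ := hLip
  have hexc : ContinuousAt (fun p : X × P => ex' p.1 p.2) (x₀, q₀) :=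
    continuousAt_of_norm_sub_le_mul (F := fun p : X × P => ex' p.1 p.2) (K := Lip) (by
      filter_upwards [hUL] with p hp
      exact (hULip p hp _ (mem_of_mem_nhds hUL)).1)
  have hexxc : ContinuousAt (fun p : X × P => ex'' p.1 p.2) (x₀, q₀) :=
    continuousAt_of_norm_sub_le_mul (F := fun p : X × P => ex'' p.1 p.2) (K := Lip) (by
      filter_upwards [hUL] with p hp
      exact (hULip p hp _ (mem_of_mem_nhds hUL)).2)
  obtain ⟨K, hK, hsolK⟩ :=
    exists_norm_sub_le_of_two_norm_estimate (half_pos hκ) hM hco hsolGE hkpos hsolLip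
  have hx₀U : x₀u ∈ U1 := mem_of_mem_nhds hU1
  have hq₀U : q₀ ∈ U2 := mem_of_mem_nhds hU2
  obtain ⟨ρ, hρ, hρV⟩ := Metric.mem_nhds_iff.1 hVh
  obtain ⟨ρ₁, hρ₁, hρU1⟩ := Metric.mem_nhds_iff.1 hU1
  obtain ⟨ρ₂, hρ₂, hρU2⟩ := Metric.mem_nhds_iff.1 hU2
  -- the second derivative of the restricted Lagrangian restricts `A`
  have hD : ∀ v, ιX' (Lu'' x₀u q₀ lam₀u v) = A (ιX v) := by
    have h1 := ιX'.hasFDerivAt.comp x₀u (hLu'' x₀u hx₀U q₀ hq₀U lam₀u)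
    have h2 := HasFDerivAt.comp x₀u (hx₀u.symm ▸ hA) ιX.hasFDerivAt
    have h3 := h1.unique (h2.congr_of_eventuallyEq (by
      filter_upwards [hU1] with z hz
      simp [hfud z hz, headj z hz q₀ hq₀U, hlam₀u]))
    intro v
    simpa using congrArg (fun S : Xu →L[ℝ] X => S v) h3
  set β : P → Xu × Wu → Xu' × W := fun q p =>
    (Lu'' x₀u q₀ lam₀u (p.1 - x₀u) + eadj x₀u q₀ p.2 + fud x₀u - (fud p.1 + eadj p.1 q p.2),
      ex' x₀ q₀ (ιX p.1) - ex' x₀ q₀ x₀ - e (ιX p.1) q) with hβ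
  have hβι : ∀ q p, A (ιX p.1) + (adjoint (ex' x₀ q₀)) (ιW p.2) + f' x₀ - A x₀ - ιX' (β q p).1
      = ιX' (fud p.1 + eadj p.1 q p.2) := by
    intro q p
    have h1 := headj x₀u hx₀U q₀ hq₀U p.2
    have h2 := hfud x₀u hx₀U
    rw [hx₀u] at h1 h2
    have h3 : ιX' (β q p).1 = A (ιX p.1) - A x₀ + (adjoint (ex' x₀ q₀)) (ιW p.2) + f' x₀
        - ιX' (fud p.1 + eadj p.1 q p.2) := by
      simp only [hβ]
      rw [map_sub, map_add, map_add, h1, h2, hD, map_sub, map_sub, hx₀u]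
    rw [h3]; abel
  have hβ₀ : β q₀ (x₀u, lam₀u) = 0 := by
    simp only [hβ, hx₀u, hx₀e, sub_self, map_zero, zero_add]
    rw [add_comm, sub_self, Prod.mk_zero_zero]
  have hsol₀ : sol 0 = (x₀u, lam₀u) := by
    have h0 := hβι q₀ (x₀u, lam₀u)
    rw [hβ₀] at h0
    simp only [hx₀u, hlam₀u] at h0
    obtain ⟨h1, h2⟩ := hsolu 0 (mem_of_mem_nhds hVh) x₀ lam₀ hx₀C (by
      intro c hc
      rw [h0, map_add, hfud x₀u hx₀U, headj x₀u hx₀U q₀ hq₀U, hx₀u, hlam₀u]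
      exact hlam₀ c hc) (by simp)
    exact Prod.ext (hιX (by rw [← h1, hx₀u])) (hιW (by rw [← h2, hlam₀u]))
  obtain ⟨δ₁, hδ₁, hrem₁⟩ := exists_forall_affine_remainder_le hU1 hU2 hLu'' hLu''cont hν hH3b
    (ε := 1 / (4 * K)) (by positivity)
  obtain ⟨δ₂, hδ₂, hrem₂⟩ := exists_forall_norm_sub_sub_le hex' hexc
    (ε := 1 / (2 * K * (‖ιX‖ + 1))) (by positivity)
  set r := min (min (δ₁ / 2) (δ₂ / (2 * (‖ιX‖ + 1)))) (min (ρ₁ / 2) (min 1 (K * ρ))) with hr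
  have hr0 : 0 < r := by positivity
  have hr₁ : r < δ₁ :=
    ((min_le_left _ _).trans (min_le_left _ _)).trans_lt (half_lt_self hδ₁)
  have hr₂ : ‖ιX‖ * r < δ₂ := by
    have h1 : r ≤ δ₂ / (2 * (‖ιX‖ + 1)) := (min_le_left _ _).trans (min_le_right _ _)
    rw [le_div_iff₀ (by positivity)] at h1
    nlinarith [norm_nonneg ιX]
  have hr₃ : r < ρ₁ :=
    ((min_le_right _ _).trans (min_le_left _ _)).trans_lt (half_lt_self hρ₁)
  have hr₄ : r ≤ 1 := (min_le_right _ _).trans ((min_le_right _ _).trans (min_le_left _ _))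
  have hr₅ : r ≤ K * ρ := (min_le_right _ _).trans ((min_le_right _ _).trans (min_le_right _ _))
  set ν' := ν * (‖lam₀u‖ + 1) with hν'
  have hν'0 : 0 < ν' := by positivity
  set η := min (min δ₁ δ₂) (min ρ₂ (r / (2 * K * ν'))) with hη
  have hη0 : 0 < η := by positivity
  set p₀ : Xu × Wu := (x₀u, lam₀u) with hp₀
  have hball : ∀ p ∈ Metric.closedBall p₀ r, dist p.1 x₀u ≤ r ∧ dist p.2 lam₀u ≤ r :=
    fun p hp => ⟨(le_max_left _ _).trans hp, (le_max_right _ _).trans hp⟩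
  have hιball : ∀ p ∈ Metric.closedBall p₀ r, ιX p.1 ∈ Metric.ball x₀ δ₂ := by
    intro p hp
    rw [Metric.mem_ball, ← hx₀u, dist_eq_norm, ← map_sub]
    refine (le_opNorm _ _).trans_lt (lt_of_le_of_lt ?_ hr₂)
    gcongr
    rw [← dist_eq_norm]
    exact (hball p hp).1
  have hpU1 : ∀ p ∈ Metric.closedBall p₀ r, p.1 ∈ U1 := fun p hp =>
    hρU1 ((hball p hp).1.trans_lt hr₃)
  have hNη : ∀ q ∈ Metric.ball q₀ η, q ∈ Metric.ball q₀ δ₁ ∧ q ∈ Metric.ball q₀ δ₂ ∧ q ∈ U2 ∧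
      ν' * dist q q₀ < r / (2 * K) := by
    intro q hq
    rw [Metric.mem_ball, hη, lt_min_iff, lt_min_iff, lt_min_iff] at hq
    refine ⟨hq.1.1, hq.1.2, hρU2 hq.2.1, ?_⟩
    have h1 := hq.2.2
    rw [lt_div_iff₀ (by positivity)] at h1 ⊢
    linarith
  have hp₀mem : p₀ ∈ Metric.closedBall p₀ r := Metric.mem_closedBall_self hr0.le
  have hq₀mem : q₀ ∈ Metric.ball q₀ η := Metric.mem_ball_self hη0
  have hβp : ∀ q ∈ Metric.ball q₀ η, ∀ p ∈ Metric.closedBall p₀ r,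
      ∀ p' ∈ Metric.closedBall p₀ r, ‖β q p - β q p'‖ ≤ 1 / (2 * K) * ‖p - p'‖ := by
    intro q hq p hp p' hp'
    have hn1 : ‖p.1 - p'.1‖ ≤ ‖p - p'‖ := norm_fst_le (p - p')
    have hn2 : ‖p.2 - p'.2‖ ≤ ‖p - p'‖ := norm_snd_le (p - p')
    refine max_le ?_ ?_
    · have h1 := hrem₁ q (hNη q hq).1 p.1 ((hball p hp).1.trans_lt hr₁) p'.1
        ((hball p' hp').1.trans_lt hr₁) p.2 ((hball p hp).2.trans_lt hr₁) p'.2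
      have h2 : (β q p - β q p').1 = Lu'' x₀u q₀ lam₀u (p.1 - p'.1) + eadj x₀u q₀ (p.2 - p'.2)
          - ((fud p.1 + eadj p.1 q p.2) - (fud p'.1 + eadj p'.1 q p'.2)) := by
        simp only [hβ, Prod.mk_sub_mk, map_sub]
        abel
      rw [h2]
      refine h1.trans ?_
      calc 1 / (4 * K) * (‖p.1 - p'.1‖ + ‖p.2 - p'.2‖)
          ≤ 1 / (4 * K) * (‖p - p'‖ + ‖p - p'‖) := by gcongr
        _ = 1 / (2 * K) * ‖p - p'‖ := by field_simp; ring
    · have h1 := hrem₂ q (hNη q hq).2.1 _ (hιball p hp) _ (hιball p' hp')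
      have h2 : (β q p - β q p').2 = -(e (ιX p.1) q - e (ιX p'.1) q
          - ex' x₀ q₀ (ιX p.1 - ιX p'.1)) := by
        simp only [hβ, Prod.mk_sub_mk, map_sub]
        abel
      rw [h2, norm_neg]
      refine h1.trans ?_
      have h3 : ‖ιX p.1 - ιX p'.1‖ ≤ (‖ιX‖ + 1) * ‖p - p'‖ := by
        rw [← map_sub]
        refine (le_opNorm _ _).trans ?_
        gcongr
        linarith
      calc 1 / (2 * K * (‖ιX‖ + 1)) * ‖ιX p.1 - ιX p'.1‖
          ≤ 1 / (2 * K * (‖ιX‖ + 1)) * ((‖ιX‖ + 1) * ‖p - p'‖) := by gcongr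
        _ = 1 / (2 * K) * ‖p - p'‖ := by field_simp
  have hβq : ∀ q ∈ Metric.ball q₀ η, ∀ q' ∈ Metric.ball q₀ η, ∀ p ∈ Metric.closedBall p₀ r,
      ‖β q p - β q' p‖ ≤ ν' * ‖q - q'‖ := by
    intro q hq q' hq' p hp
    refine max_le ?_ ?_
    · have h1 := hH3b p.1 (hpU1 p hp) q (hNη q hq).2.2.1 q' (hNη q' hq').2.2.1
      have h2 : (β q p - β q' p).1 = -((eadj p.1 q - eadj p.1 q') p.2) := by
        simp only [hβ, Prod.mk_sub_mk, _root_.sub_apply]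
        abel
      have h3 : ‖p.2‖ ≤ ‖lam₀u‖ + 1 := by
        have h4 := norm_sub_norm_le p.2 lam₀u
        rw [← dist_eq_norm] at h4
        linarith [(hball p hp).2]
      rw [h2, norm_neg]
      calc _ ≤ ‖eadj p.1 q - eadj p.1 q'‖ * ‖p.2‖ := le_opNorm _ _
        _ ≤ (ν * ‖q - q'‖) * (‖lam₀u‖ + 1) := by gcongr
        _ = ν' * ‖q - q'‖ := by rw [hν']; ring
    · have h1 := hH3a p.1 (hpU1 p hp) q (hNη q hq).2.2.1 q' (hNη q' hq').2.2.1
      have h2 : (β q p - β q' p).2 = -(e (ιX p.1) q - e (ιX p.1) q') := by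
        simp only [hβ, Prod.mk_sub_mk]
        abel
      rw [h2, norm_neg]
      refine h1.trans ?_
      gcongr
      rw [hν']
      nlinarith [norm_nonneg lam₀u]
  have hβρ : ∀ q ∈ Metric.ball q₀ η, ∀ p ∈ Metric.closedBall p₀ r,
      β q p ∈ Metric.ball (0 : Xu' × W) ρ := by
    intro q hq p hp
    have h1 := hβp q hq p hp p₀ hp₀mem
    have h2 := hβq q hq q₀ hq₀mem p₀ hp₀mem
    have h3 := (hNη q hq).2.2.2
    rw [hβ₀, sub_zero, ← dist_eq_norm] at h2
    rw [← dist_eq_norm p] at h1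
    have h4 : 1 / (2 * K) * dist p p₀ ≤ 1 / (2 * K) * r := by gcongr; exact hp
    have h5 : r / (2 * K) ≤ ρ / 2 := by
      rw [div_le_iff₀ (by positivity)]; linarith
    have h6 : 1 / (2 * K) * r = r / (2 * K) := by ring
    have h7 := norm_add_le (β q p - β q p₀) (β q p₀)
    rw [sub_add_cancel] at h7
    rw [mem_ball_zero_iff]
    linarith
  have hβV : ∀ q ∈ Metric.ball q₀ η, ∀ p ∈ Metric.closedBall p₀ r, β q p ∈ Vh :=
    fun q hq p hp => hρV (hβρ q hq p hp)
  have hTq : ∀ q ∈ Metric.ball q₀ η, ∀ q' ∈ Metric.ball q₀ η, ∀ p ∈ Metric.closedBall p₀ r,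
      dist (sol (β q p)) (sol (β q' p)) ≤ K * ν' * dist q q' := by
    intro q hq q' hq' p hp
    rw [dist_eq_norm, dist_eq_norm, mul_assoc]
    exact (hsolK _ (hβV q hq p hp) _ (hβV q' hq' p hp)).trans
      (mul_le_mul_of_nonneg_left (hβq q hq q' hq' p hp) hK.le)
  have hTp₀ : sol (β q₀ p₀) = p₀ := by rw [hβ₀, hsol₀]
  obtain ⟨xl, hxl, hxlLip⟩ := exists_fixedPoint_family (T := fun q p => sol (β q p)) hr0
    (fun q hq p hp p' hp' => by
      rw [dist_eq_norm, dist_eq_norm]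
      refine (hsolK _ (hβV q hq p hp) _ (hβV q hq p' hp')).trans ?_
      refine (mul_le_mul_of_nonneg_left (hβp q hq p hp p' hp') hK.le).trans_eq ?_
      field_simp)
    (fun q hq => by
      have h1 := hTq q hq q₀ hq₀mem p₀ hp₀mem
      rw [hTp₀] at h1
      have h2 := mul_lt_mul_of_pos_left (hNη q hq).2.2.2 hK
      have h3 : K * (r / (2 * K)) = r / 2 := by field_simp
      linarith) hTq
  have hxl₀ : xl q₀ = p₀ := ((hxl q₀ hq₀mem).2.2 p₀ hp₀mem hTp₀).symm
  have hxlV : ∀ q ∈ Metric.ball q₀ η, ∀ c ∈ C,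
      0 ≤ ⟪ιX' (fud (xl q).1 + eadj (xl q).1 q (xl q).2), c - ιX (xl q).1⟫ := by
    intro q hq
    obtain ⟨h1, h2, -⟩ := hxl q hq
    have h3 := (hsolGE _ (hβV q hq _ h1)).1
    rwa [h2, hβι] at h3
  have hxlC : ∀ q ∈ Metric.ball q₀ η, ιX (xl q).1 ∈ C := by
    intro q hq
    obtain ⟨h1, h2, -⟩ := hxl q hq
    have h3 := (hsolGE _ (hβV q hq _ h1)).2.1
    rwa [h2] at h3
  have hxle : ∀ q ∈ Metric.ball q₀ η, e (ιX (xl q).1) q = 0 := by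
    intro q hq
    obtain ⟨h1, h2, -⟩ := hxl q hq
    have h3 := (hsolGE _ (hβV q hq _ h1)).2.2
    rw [h2] at h3
    exact sub_eq_self.1 h3.symm
  have hxlt : Tendsto xl (𝓝 q₀) (𝓝 p₀) := by
    rw [← hxl₀]
    refine continuousAt_of_norm_sub_le_mul (K := 2 * (K * ν')) ?_
    filter_upwards [Metric.ball_mem_nhds q₀ hη0] with q hq
    simpa [dist_eq_norm] using hxlLip q hq q₀ hq₀mem
  refine ⟨Metric.closedBall p₀ r, Metric.ball q₀ η, 2 * (2 * (K * ν')), xl,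
    Metric.closedBall_mem_nhds _ hr0, Metric.ball_mem_nhds _ hη0, by positivity,
    fun q hq => ⟨(hxl q hq).1, hxlC q hq, fun c hc => hxlV q hq c hc.1, hxle q hq,
      fun p hp hpC hpV hpe => ?_⟩, fun q₁ hq₁ q₂ hq₂ => ?_, ?_⟩
  · refine (hxl q hq).2.2 p hp ?_
    have hβ2 : (β q p).2 = ex' x₀ q₀ (ιX p.1) - ex' x₀ q₀ x₀ := by simp [hβ, hpe]
    have hg : ∀ y : X, ∀ l : W, A y + (adjoint (ex' x₀ q₀)) l + f' x₀ - A x₀ - ιX' (β q p).1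
        = A y + (adjoint (ex' x₀ q₀)) l + (f' x₀ - A x₀ - ιX' (β q p).1) := fun y l => by abel
    have h1 := inner_nonneg_of_inter hCcv hκ hcoer (S := Set.range ιX) (x := ιX p.1)
      (g := f' x₀ - A x₀ - ιX' (β q p).1) (lam := ιW p.2) hpC
      (fun c hc => by rw [← hg, hβι]; exact hpV c hc) (by
        have hcont : ContinuousAt (fun w : W => ((β q p).1, w - ex' x₀ q₀ x₀))
            (ex' x₀ q₀ (ιX p.1)) := by fun_prop
        have hmem : Vh ∈ 𝓝 ((β q p).1, ex' x₀ q₀ (ιX p.1) - ex' x₀ q₀ x₀) := by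
          rw [← hβ2]
          exact mem_of_superset (Metric.isOpen_ball.mem_nhds (hβρ q hq p hp)) hρV
        filter_upwards [hcont hmem] with w hw
        obtain ⟨k1, k2, k3⟩ := hsolGE _ hw
        exact ⟨_, ⟨k2, Set.mem_range_self _⟩, ιW (sol _).2, sub_left_injective k3,
          fun c hc => by rw [← hg]; exact k1 c hc⟩)
    obtain ⟨k1, k2⟩ := hsolu _ (hβV q hq p hp) (ιX p.1) (ιW p.2) hpC
      (fun c hc => by rw [hg]; exact h1 c hc) hβ2.symm
    exact Prod.ext (hιX k1.symm) (hιW k2.symm)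
  · have h1 := hxlLip q₁ hq₁ q₂ hq₂
    rw [dist_eq_norm, dist_eq_norm] at h1
    have h2 : ‖(xl q₁).1 - (xl q₂).1‖ ≤ ‖xl q₁ - xl q₂‖ := norm_fst_le (xl q₁ - xl q₂)
    have h3 : ‖(xl q₁).2 - (xl q₂).2‖ ≤ ‖xl q₁ - xl q₂‖ := norm_snd_le (xl q₁ - xl q₂)
    linarith
  · obtain ⟨ε', hε', hMε⟩ : ∃ ε' > 0, M * ε' ^ 2 + κ / 4 ≤ κ / 2 := by
      refine ⟨√(κ / (4 * (M + 1))), by positivity, ?_⟩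
      rw [Real.sq_sqrt (by positivity)]
      have : M * (κ / (4 * (M + 1))) ≤ κ / 4 := by
        rw [mul_div_assoc', div_le_div_iff₀ (by positivity) (by positivity)]
        nlinarith
      linarith
    obtain ⟨δ₃, hδ₃, hrem₃⟩ := exists_forall_lagrangian_gradient_le hfC2.self_of_nhds hf' hex''
      hexxc hA (ε := κ / 4) (by positivity)
    obtain ⟨δ₄, hδ₄, hrem₄⟩ := exists_forall_norm_sub_sub_le hex' hexc hε'
    obtain ⟨δ₅, hδ₅, hf₅⟩ := Metric.eventually_nhds_iff.1 hf'
    obtain ⟨δ₆, hδ₆, he₆⟩ := Metric.eventually_nhds_iff.1 hex'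
    set δ := min (min δ₃ δ₄) (min δ₅ δ₆) with hδ
    have hδ0 : 0 < δ := by positivity
    have b₃ : δ ≤ δ₃ := (min_le_left _ _).trans (min_le_left _ _)
    have b₄ : δ ≤ δ₄ := (min_le_left _ _).trans (min_le_right _ _)
    have b₅ : δ ≤ δ₅ := (min_le_right _ _).trans (min_le_left _ _)
    have b₆ : δ ≤ δ₆ := (min_le_right _ _).trans (min_le_right _ _)
    have t1 : Tendsto (fun q => ιX (xl q).1) (𝓝 q₀) (𝓝 x₀) := by
      rw [← hx₀u]
      exact (ιX.continuous.tendsto _).comp ((continuous_fst.tendsto _).comp hxlt)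
    have t2 : Tendsto (fun q => ιW (xl q).2) (𝓝 q₀) (𝓝 lam₀) := by
      rw [← hlam₀u]
      exact (ιW.continuous.tendsto _).comp ((continuous_snd.tendsto _).comp hxlt)
    have hev : ∀ᶠ q in 𝓝 q₀, q ∈ Metric.ball q₀ η ∧ q ∈ Metric.ball q₀ δ ∧
        ιX (xl q).1 ∈ Metric.ball x₀ δ ∧ ιW (xl q).2 ∈ Metric.ball lam₀ δ := by
      filter_upwards [Metric.ball_mem_nhds q₀ hη0, Metric.ball_mem_nhds q₀ hδ0,
        t1 (Metric.ball_mem_nhds x₀ hδ0), t2 (Metric.ball_mem_nhds lam₀ hδ0)] with q h1 h2 h3 h4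
      exact ⟨h1, h2, h3, h4⟩
    refine ⟨_, hev, fun q hq => hq.1, fun q hq => ?_⟩
    obtain ⟨hqη, hqδ, hxδ, hlδ⟩ := hq
    refine ⟨δ - dist (ιX (xl q).1) x₀, sub_pos.2 hxδ, fun x hxC hxe hxn => ?_⟩
    have hxB : x ∈ Metric.ball x₀ δ := by
      rw [← dist_eq_norm] at hxn
      rw [Metric.mem_ball]
      linarith [dist_triangle x (ιX (xl q).1) x₀]
    refine le_of_lagrangian_coercive (C := C) (convex_ball x₀ δ)
      (fun y hy => hf₅ (lt_of_lt_of_le hy b₅))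
      (fun y hy => he₆ (y := (y, q)) (max_lt (lt_of_lt_of_le hy b₆) (lt_of_lt_of_le hqδ b₆)))
      hM hco hMε
      (fun y hy z hz => hrem₃ q (Metric.ball_subset_ball b₃ hqδ) (ιW (xl q).2)
        (Metric.ball_subset_ball b₃ hlδ) y (Metric.ball_subset_ball b₃ hy) z
        (Metric.ball_subset_ball b₃ hz))
      (fun y hy z hz => hrem₄ q (Metric.ball_subset_ball b₄ hqδ) y
        (Metric.ball_subset_ball b₄ hy) z (Metric.ball_subset_ball b₄ hz))
      hxδ (hxle q hqη) (fun c hc => ?_) hxB hxC hxe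
    have h1 := hxlV q hqη c hc
    have hU := hpU1 _ (hxl q hqη).1
    rwa [map_add, hfud _ hU, headj _ hU q (hNη q hqη).2.2.1] at h1
end

section
/- Let x₀ ∈ C, g ∈ X, and assume the regular point condition 0 ∈ int E(C − x₀) (interior in W) and the coercivity condition ⟨A x, x⟩ ≥ κ‖x‖² for all x ∈ ker E. Then there exists a neighborhood Ṽ of the origin in X × W such that for every (β₁, β₂) ∈ Ṽ, setting a = g − A x₀ − β₁ and b = E x₀ + β₂, the set S(b) = {x ∈ C : E x = b} is nonempty, the problem of minimizing ½⟨A x, x⟩ + ⟨a, x⟩ over S(b) has a unique solution x(β₁, β₂), and there exists λ(β₁, β₂) ∈ W such that the pair (x(β₁, β₂), λ(β₁, β₂)) solves the linearized generalized equation: ⟨a + A x + E*λ, c − x⟩ ≥ 0 for all c ∈ C, together with E x = b. -/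
open scoped RealInnerProductSpace
open Filter Topology

/-- A sequence whose squared mutual distances are bounded by `M (1/(n+1) + 1/(m+1))` is Cauchy. -/
theorem cauchySeq_of_sq_norm_sub_le {X : Type*} [NormedAddCommGroup X] {u : ℕ → X} {M : ℝ}
    (h : ∀ n m : ℕ, ‖u n - u m‖ ^ 2 ≤ M * (1 / ((n : ℝ) + 1) + 1 / ((m : ℝ) + 1))) :
    CauchySeq u := by
  rw [Metric.cauchySeq_iff]
  intro ε hε
  have hlim : Tendsto (fun n : ℕ => M * (1 / ((n : ℝ) + 1) + 1 / ((n : ℝ) + 1))) atTop (𝓝 0) := by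
    simpa using (tendsto_one_div_add_atTop_nhds_zero_nat.add
      (tendsto_one_div_add_atTop_nhds_zero_nat (𝕜 := ℝ))).const_mul M
  have hM : 0 ≤ M := by
    have := h 0 0
    norm_num at this
    linarith
  obtain ⟨N, hN⟩ := (hlim.eventually (gt_mem_nhds (show (0 : ℝ) < ε ^ 2 by positivity))).exists
  refine ⟨N, fun m hm n hn => ?_⟩
  rw [dist_eq_norm]
  refine lt_of_pow_lt_pow_left₀ 2 hε.le (((h m n).trans ?_).trans_lt hN)
  gcongr

section Quadratic

variable {X : Type*} [NormedAddCommGroup X] [InnerProductSpace ℝ X]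

/-- Second-order expansion of a quadratic functional with symmetric operator. -/
theorem quadratic_add {Q : X →L[ℝ] X} (hQ : ∀ u v, ⟪Q u, v⟫ = ⟪Q v, u⟫) (a x d : X) :
    (1 / 2) * ⟪Q (x + d), x + d⟫ + ⟪a, x + d⟫ =
      ((1 / 2) * ⟪Q x, x⟫ + ⟪a, x⟫) + ⟪Q x + a, d⟫ + (1 / 2) * ⟪Q d, d⟫ := by
  simp only [map_add, inner_add_left, inner_add_right]
  rw [hQ d x]
  ring

/-- A minimizer of a quadratic functional over a convex set solves the variational inequality. -/
theorem inner_nonneg_of_quadratic_min {Q : X →L[ℝ] X} (hQ : ∀ u v, ⟪Q u, v⟫ = ⟪Q v, u⟫)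
    {K : Set X} (hK : Convex ℝ K) {a x : X} (hx : x ∈ K)
    (hmin : ∀ v ∈ K, (1 / 2) * ⟪Q x, x⟫ + ⟪a, x⟫ ≤ (1 / 2) * ⟪Q v, v⟫ + ⟪a, v⟫)
    {v : X} (hv : v ∈ K) : 0 ≤ ⟪Q x + a, v - x⟫ := by
  have key : ∀ t ∈ Set.Ioc (0 : ℝ) 1,
      0 ≤ ⟪Q x + a, v - x⟫ + t * ((1 / 2) * ⟪Q (v - x), v - x⟫) := by
    rintro t ⟨ht0, ht1⟩
    have h := hmin _ (hK.add_smul_sub_mem hx hv ⟨ht0.le, ht1⟩)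
    rw [quadratic_add hQ] at h
    simp only [map_smul, inner_smul_left, inner_smul_right, RCLike.conj_to_real] at h
    refine nonneg_of_mul_nonneg_right ?_ ht0
    linarith
  have hlim : Tendsto (fun t : ℝ => ⟪Q x + a, v - x⟫ + t * ((1 / 2) * ⟪Q (v - x), v - x⟫))
      (𝓝[>] 0) (𝓝 ⟪Q x + a, v - x⟫) := by
    refine tendsto_nhdsWithin_of_tendsto_nhds (Continuous.tendsto' (by fun_prop) _ _ (by simp))
  exact ge_of_tendsto hlim
    (Filter.eventually_of_mem (Ioc_mem_nhdsGT zero_lt_one) key)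

/-- Existence of a minimizer of a quadratic functional over a closed convex set on whose
differences the operator is coercive. -/
theorem exists_quadratic_min [CompleteSpace X] {Q : X →L[ℝ] X}
    (hQ : ∀ u v, ⟪Q u, v⟫ = ⟪Q v, u⟫) {K : Set X} (hne : K.Nonempty) (hcl : IsClosed K)
    (hK : Convex ℝ K) {κ : ℝ} (hκ : 0 < κ)
    (hco : ∀ u ∈ K, ∀ v ∈ K, κ * ‖u - v‖ ^ 2 ≤ ⟪Q (u - v), u - v⟫) (a : X) :
    ∃ x ∈ K, ∀ v ∈ K, (1 / 2) * ⟪Q x, x⟫ + ⟪a, x⟫ ≤ (1 / 2) * ⟪Q v, v⟫ + ⟪a, v⟫ := by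
  set q : X → ℝ := fun v => (1 / 2) * ⟪Q v, v⟫ + ⟪a, v⟫ with hq
  obtain ⟨v₀, hv₀⟩ := hne
  have hbdd : BddBelow (q '' K) := by
    refine ⟨q v₀ - ‖Q v₀ + a‖ ^ 2 / (2 * κ), ?_⟩
    rintro _ ⟨v, hv, rfl⟩
    have h := quadratic_add hQ a v₀ (v - v₀)
    rw [add_sub_cancel] at h
    have h1 := hco v hv v₀ hv₀
    have h2 := neg_le_of_abs_le (abs_real_inner_le_norm (Q v₀ + a) (v - v₀))
    have h3 : ‖Q v₀ + a‖ * ‖v - v₀‖ ≤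
        ‖Q v₀ + a‖ ^ 2 / (2 * κ) + (1 / 2) * (κ * ‖v - v₀‖ ^ 2) := by
      have : ‖Q v₀ + a‖ ^ 2 / (2 * κ) + (1 / 2) * (κ * ‖v - v₀‖ ^ 2)
          - ‖Q v₀ + a‖ * ‖v - v₀‖ = (‖Q v₀ + a‖ - κ * ‖v - v₀‖) ^ 2 / (2 * κ) := by
        field_simp
        ring
      have : 0 ≤ (‖Q v₀ + a‖ - κ * ‖v - v₀‖) ^ 2 / (2 * κ) := by positivity
      linarith
    simp only [hq]
    linarith
  set m := sInf (q '' K)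
  have hm : ∀ v ∈ K, m ≤ q v := fun v hv => csInf_le hbdd ⟨v, hv, rfl⟩
  have hex : ∀ n : ℕ, ∃ u ∈ K, q u < m + 1 / ((n : ℝ) + 1) := by
    intro n
    obtain ⟨_, ⟨u, hu, rfl⟩, h⟩ := exists_lt_of_csInf_lt (Set.Nonempty.image q ⟨v₀, hv₀⟩)
      (show m < m + 1 / ((n : ℝ) + 1) from lt_add_of_pos_right _ (by positivity))
    exact ⟨u, hu, h⟩
  choose u huK hu using hex
  have hcau : CauchySeq u := by
    refine cauchySeq_of_sq_norm_sub_le (M := 4 / κ) fun i j => ?_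
    have h1 := hco _ (huK i) _ (huK j)
    have h2 := quadratic_add hQ a (u j) (u i - u j)
    have h3 := quadratic_add hQ a (u j) ((1 / 2 : ℝ) • (u i - u j))
    have h4 := hm _ (hK.add_smul_sub_mem (huK j) (huK i)
      (show (1 / 2 : ℝ) ∈ Set.Icc 0 1 by norm_num))
    rw [add_sub_cancel] at h2
    simp only [map_smul, inner_smul_left, inner_smul_right, RCLike.conj_to_real, hq] at h3 h4
    have h5 := hu i
    have h6 := hu j
    simp only [hq] at h5 h6
    rw [div_mul_eq_mul_div, le_div_iff₀ hκ]
    linarith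
  obtain ⟨x, hx⟩ := cauchySeq_tendsto_of_complete hcau
  refine ⟨x, hcl.mem_of_tendsto hx (Eventually.of_forall huK), fun v hv => ?_⟩
  have hqc : Continuous q := by fun_prop
  have hlim : Tendsto (fun n : ℕ => m + 1 / ((n : ℝ) + 1)) atTop (𝓝 m) := by
    simpa using (tendsto_one_div_add_atTop_nhds_zero_nat (𝕜 := ℝ)).const_add m
  exact (le_of_tendsto_of_tendsto' ((hqc.tendsto x).comp hx) hlim fun n => (hu n).le).trans
    (hm v hv)

end Quadratic

/-- A bounded sequence in a Hilbert space has a weak limit along some nontrivial filter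
finer than `atTop`. -/
theorem exists_weak_limit_of_bounded {W : Type*} [NormedAddCommGroup W] [InnerProductSpace ℝ W]
    [CompleteSpace W] {l : ℕ → W} {M : ℝ} (hl : ∀ n, ‖l n‖ ≤ M) :
    ∃ (F : Ultrafilter ℕ) (z : W), (F : Filter ℕ) ≤ atTop ∧
      ∀ w, Tendsto (fun n => ⟪l n, w⟫) F (𝓝 ⟪z, w⟫) := by
  set f : ℕ → WeakDual ℝ W := fun n => StrongDual.toWeakDual (InnerProductSpace.toDual ℝ W (l n))
  have hc : IsCompact (WeakDual.toStrongDual ⁻¹' Metric.closedBall (0 : StrongDual ℝ W) M) :=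
    WeakDual.isCompact_closedBall _ _
  obtain ⟨z, -, hz⟩ := hc.ultrafilter_le_nhds ((Ultrafilter.of atTop).map f) (by
    refine le_principal_iff.2 (Filter.mem_map.2 (Filter.univ_mem' fun n => ?_))
    simpa [f] using hl n)
  refine ⟨Ultrafilter.of atTop, (InnerProductSpace.toDual ℝ W).symm (WeakDual.toStrongDual z),
    Ultrafilter.of_le _, fun w => ?_⟩
  have h := ((WeakDual.eval_continuous w).tendsto z).comp (show Tendsto f _ (𝓝 z) from hz)
  rw [InnerProductSpace.toDual_symm_apply]
  exact h

section Multiplier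

variable {X W : Type*} [NormedAddCommGroup X] [InnerProductSpace ℝ X] [CompleteSpace X]
    [NormedAddCommGroup W] [InnerProductSpace ℝ W] [CompleteSpace W]

/-- The solution of the regularized penalty problem, expressed as a variational inequality for
the displacement `d` from `x`. -/
theorem exists_penalty_displacement (E : X →L[ℝ] W) {C : Set X} (hCcl : IsClosed C)
    (hCcv : Convex ℝ C) {x : X} (hx : x ∈ C) (p : X) {r : ℝ} (hr : 0 ≤ r) :
    ∃ d : X, x + d ∈ C ∧
      ∀ c ∈ C, 0 ≤ ⟪p + d, c - x - d⟫ + ⟪r • E d, E (c - x - d)⟫ := by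
  set Q : X →L[ℝ] X := ContinuousLinearMap.id ℝ X + r • ((ContinuousLinearMap.adjoint E) ∘L E)
    with hQdef
  have hQi : ∀ u v, ⟪Q u, v⟫ = ⟪u, v⟫ + r * ⟪E u, E v⟫ := by
    intro u v
    simp [hQdef, inner_add_left, inner_smul_left, ContinuousLinearMap.adjoint_inner_left]
  have hQ : ∀ u v, ⟪Q u, v⟫ = ⟪Q v, u⟫ := by
    intro u v
    rw [hQi, hQi, real_inner_comm, real_inner_comm (E u)]
  obtain ⟨y, hy, hmin⟩ := exists_quadratic_min hQ ⟨x, hx⟩ hCcl hCcv one_pos (fun u _ v _ => by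
    rw [hQi, real_inner_self_eq_norm_sq, real_inner_self_eq_norm_sq, one_mul]
    have : 0 ≤ r * ‖E (u - v)‖ ^ 2 := by positivity
    linarith) (p - Q x)
  refine ⟨y - x, by simpa using hy, fun c hc => ?_⟩
  have h := inner_nonneg_of_quadratic_min hQ hCcv hy hmin hc
  have e : Q y + (p - Q x) = p + Q (y - x) := by rw [map_sub]; abel
  rw [e, inner_add_left, hQi] at h
  rw [sub_sub_sub_cancel_right, inner_add_left, real_inner_smul_left]
  linarith

/-- Lagrange multiplier rule: if `x` minimizes the linear functional `⟪p, ·⟫` over the points of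
`C` with the same image under `E`, and `E (C - x)` is absorbing, then a multiplier exists. -/
theorem exists_multiplier (E : X →L[ℝ] W) {C : Set X} (hCcl : IsClosed C)
    (hCcv : Convex ℝ C) {x : X} (hx : x ∈ C) (p : X)
    (hp : ∀ c ∈ C, E c = E x → 0 ≤ ⟪p, c - x⟫)
    (habs : ∀ w : W, ∃ t : ℝ, 0 < t ∧ ∃ c ∈ C, E (c - x) = t • w) :
    ∃ lam : W, ∀ c ∈ C, 0 ≤ ⟪p, c - x⟫ + ⟪lam, E (c - x)⟫ := by
  choose d hdC hd using fun n : ℕ => exists_penalty_displacement E hCcl hCcv hx p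
    (show (0 : ℝ) ≤ (n : ℝ) + 1 by positivity)
  set l : ℕ → W := fun n => ((n : ℝ) + 1) • E (d n) with hl
  have hpen : ∀ n, 0 ≤ ⟪l n, E (d n)⟫ := fun n => by
    rw [hl, real_inner_smul_left]
    exact mul_nonneg (by positivity) real_inner_self_nonneg
  have hVI : ∀ n, ∀ c ∈ C, 0 ≤ ⟪p + d n, c - x - d n⟫ + ⟪l n, E (c - x)⟫ := fun n c hc => by
    have h := hd n c hc
    rw [map_sub E (c - x), inner_sub_right ((_ : ℝ) • E (d n))] at h
    linarith [hpen n]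
  have hself : ∀ n, ‖d n‖ ^ 2 ≤ - ⟪p, d n⟫ := fun n => by
    have h := hVI n x hx
    simp only [sub_self, zero_sub, map_zero, inner_zero_right, inner_neg_right, inner_add_left,
      real_inner_self_eq_norm_sq] at h
    linarith
  have hdb : ∀ n, ‖d n‖ ≤ ‖p‖ := fun n => by
    have h := (hself n).trans ((neg_le_abs _).trans (abs_real_inner_le_norm p (d n)))
    by_contra! hlt
    nlinarith [norm_nonneg p]
  have hlow : ∀ w, ∃ B : ℝ, ∀ n, -B ≤ ⟪l n, w⟫ := fun w => by
    obtain ⟨t, ht, c, hc, hw⟩ := habs w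
    refine ⟨(‖p‖ + ‖p‖) * (‖c - x‖ + ‖p‖) / t, fun n => ?_⟩
    have h := hVI n c hc
    rw [hw, inner_smul_right] at h
    have h1 : ⟪p + d n, c - x - d n⟫ ≤ (‖p‖ + ‖p‖) * (‖c - x‖ + ‖p‖) := by
      refine (real_inner_le_norm _ _).trans ?_
      gcongr
      · exact (norm_add_le _ _).trans (by gcongr; exact hdb n)
      · exact (norm_sub_le _ _).trans (by gcongr; exact hdb n)
    rw [neg_le, le_div_iff₀ ht]
    linarith
  obtain ⟨M, hM⟩ := banach_steinhaus (g := fun n => innerSL ℝ (l n)) fun w => by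
    obtain ⟨B, hB⟩ := hlow w
    obtain ⟨B', hB'⟩ := hlow (-w)
    refine ⟨max B B', fun n => ?_⟩
    have h1 := hB n
    have h2 := hB' n
    rw [inner_neg_right] at h2
    rw [innerSL_apply_apply, Real.norm_eq_abs, abs_le]
    constructor <;> linarith [le_max_left B B', le_max_right B B']
  simp only [innerSL_apply_norm] at hM
  have hM0 : 0 ≤ M := (norm_nonneg _).trans (hM 0)
  have hEd : ∀ n, ‖E (d n)‖ ≤ M * (1 / ((n : ℝ) + 1)) := fun n => by
    have h := hM n
    have hn : (0 : ℝ) < (n : ℝ) + 1 := by positivity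
    rw [hl, norm_smul, Real.norm_of_nonneg hn.le] at h
    rw [mul_one_div, le_div_iff₀ hn]
    linarith
  have hcau : CauchySeq d := by
    refine cauchySeq_of_sq_norm_sub_le (M := 2 * M * M) fun i j => ?_
    have h1 := hd i _ (hdC j)
    have h2 := hd j _ (hdC i)
    rw [add_sub_cancel_left] at h1 h2
    have e : ⟪p + d i, d j - d i⟫ + ⟪l i, E (d j - d i)⟫ + (⟪p + d j, d i - d j⟫
        + ⟪l j, E (d i - d j)⟫) = - ‖d i - d j‖ ^ 2 - ⟪l i - l j, E (d i) - E (d j)⟫ := by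
      rw [← real_inner_self_eq_norm_sq]
      simp only [map_sub, inner_add_left, inner_sub_left, inner_sub_right]
      ring
    have h3 : ‖l i - l j‖ ≤ M + M := (norm_sub_le _ _).trans (add_le_add (hM i) (hM j))
    have h4 : ‖E (d i) - E (d j)‖ ≤ M * (1 / ((i : ℝ) + 1)) + M * (1 / ((j : ℝ) + 1)) :=
      (norm_sub_le _ _).trans (add_le_add (hEd i) (hEd j))
    have h5 := neg_le_of_abs_le (abs_real_inner_le_norm (l i - l j) (E (d i) - E (d j)))
    have h6 := mul_le_mul h3 h4 (norm_nonneg _) (by positivity)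
    linarith
  obtain ⟨d', hd'⟩ := cauchySeq_tendsto_of_complete hcau
  have hd'C : x + d' ∈ C :=
    hCcl.mem_of_tendsto (hd'.const_add x) (Eventually.of_forall hdC)
  have hEd' : E d' = 0 := by
    refine tendsto_nhds_unique ((E.continuous.tendsto d').comp hd')
      (squeeze_zero_norm hEd ?_)
    simpa using (tendsto_one_div_add_atTop_nhds_zero_nat (𝕜 := ℝ)).const_mul M
  have hd'0 : d' = 0 := by
    have h1 := hp _ hd'C (by rw [map_add, hEd', add_zero])
    rw [add_sub_cancel_left] at h1
    have h2 : ‖d'‖ ^ 2 ≤ - ⟪p, d'⟫ :=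
      le_of_tendsto_of_tendsto' (hd'.norm.pow 2) (tendsto_const_nhds.inner hd').neg hself
    have h3 : ‖d'‖ ^ 2 = 0 := le_antisymm (by linarith) (by positivity)
    simpa using h3
  rw [hd'0] at hd'
  obtain ⟨F, z, hF, hz⟩ := exists_weak_limit_of_bounded hM
  refine ⟨z, fun c hc => ge_of_tendsto' (f := fun n => ⟪p + d n, c - x - d n⟫ + ⟪l n, E (c - x)⟫)
    (x := (F : Filter ℕ)) (Tendsto.add ?_ (hz _)) fun n => hVI n c hc⟩
  have h := hd'.mono_left hF
  simpa using (h.const_add p).inner (h.const_sub (c - x))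

end Multiplier

/-- Under the regular point condition at `x₀` and coercivity of `A` on
`ker E`, there is a neighborhood `Ṽ` of the origin in `X × W` such that for every
perturbation `(β₁, β₂) ∈ Ṽ`, with `a = g − A x₀ − β₁` and `b = E x₀ + β₂`, the feasible
set `S(b) = {x ∈ C : E x = b}` is nonempty, the quadratic problem
`min_{x ∈ S(b)} ½⟨Ax,x⟩ + ⟨a,x⟩` has a unique solution, and there exists a multiplier
`lam ∈ W` so that the pair solves the linearized generalized equation. -/
theorem stmt_3
    {X W : Type*} [NormedAddCommGroup X] [InnerProductSpace ℝ X] [CompleteSpace X]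
    [NormedAddCommGroup W] [InnerProductSpace ℝ W] [CompleteSpace W]
    (A : X →L[ℝ] X) (hA : IsSelfAdjoint A)
    (E : X →L[ℝ] W)
    (C : Set X) (hCne : C.Nonempty) (hCcl : IsClosed C) (hCcv : Convex ℝ C)
    (κ : ℝ) (hκ : 0 < κ)
    (hcoer : ∀ x : X, E x = 0 → κ * ‖x‖ ^ 2 ≤ ⟪A x, x⟫)
    (x₀ : X) (hx₀ : x₀ ∈ C) (g : X)
    (hreg : (0 : W) ∈ interior ((fun c => E (c - x₀)) '' C)) :
    ∃ V ∈ 𝓝 ((0, 0) : X × W), ∀ β₁ : X, ∀ β₂ : W, (β₁, β₂) ∈ V →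
      (∃ x ∈ C, E x = E x₀ + β₂) ∧
      (∃ x : X,
        (x ∈ C ∧ E x = E x₀ + β₂ ∧
          ∀ v ∈ C, E v = E x₀ + β₂ →
            (1 / 2) * ⟪A x, x⟫ + ⟪g - A x₀ - β₁, x⟫ ≤
              (1 / 2) * ⟪A v, v⟫ + ⟪g - A x₀ - β₁, v⟫) ∧
        (∀ y : X, (y ∈ C ∧ E y = E x₀ + β₂ ∧
            ∀ v ∈ C, E v = E x₀ + β₂ →
              (1 / 2) * ⟪A y, y⟫ + ⟪g - A x₀ - β₁, y⟫ ≤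
                (1 / 2) * ⟪A v, v⟫ + ⟪g - A x₀ - β₁, v⟫) → y = x) ∧
        (∃ lam : W,
          (∀ c ∈ C,
            0 ≤ ⟪(g - A x₀ - β₁) + A x + (ContinuousLinearMap.adjoint E) lam, c - x⟫) ∧
          E x = E x₀ + β₂)) := by
  have hQ : ∀ u v, ⟪A u, v⟫ = ⟪A v, u⟫ := fun u v => by
    rw [real_inner_comm u (A v)]
    exact hA.isSymmetric u v
  refine ⟨Set.univ ×ˢ interior ((fun c => E (c - x₀)) '' C),
    prod_mem_nhds univ_mem (isOpen_interior.mem_nhds hreg), ?_⟩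
  rintro β₁ β₂ ⟨-, hβ⟩
  set a := g - A x₀ - β₁
  have hne : ∃ x ∈ C, E x = E x₀ + β₂ := by
    obtain ⟨c, hc, h⟩ := interior_subset hβ
    refine ⟨c, hc, ?_⟩
    simp only [map_sub] at h
    rw [← h]
    abel
  refine ⟨hne, ?_⟩
  set K : Set X := C ∩ E ⁻¹' {E x₀ + β₂} with hKdef
  have hKcl : IsClosed K := hCcl.inter (isClosed_singleton.preimage E.continuous)
  have hKcv : Convex ℝ K :=
    hCcv.inter ((convex_singleton (E x₀ + β₂)).linear_preimage E.toLinearMap)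
  have hKco : ∀ u ∈ K, ∀ v ∈ K, κ * ‖u - v‖ ^ 2 ≤ ⟪A (u - v), u - v⟫ := fun u hu v hv =>
    hcoer _ (by rw [map_sub, hu.2, hv.2, sub_self])
  obtain ⟨x, hxK, hmin⟩ := exists_quadratic_min hQ hne hKcl hKcv hκ hKco a
  have hVI := fun v (hv : v ∈ K) => inner_nonneg_of_quadratic_min hQ hKcv hxK hmin hv
  refine ⟨x, ⟨hxK.1, hxK.2, fun v hv hEv => hmin v ⟨hv, hEv⟩⟩, ?_, ?_⟩
  · rintro y ⟨hyC, hEy, hy⟩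
    have h1 := hy x hxK.1 hxK.2
    have h2 := quadratic_add hQ a x (y - x)
    rw [add_sub_cancel] at h2
    have h3 := hVI y ⟨hyC, hEy⟩
    have h4 := hKco y ⟨hyC, hEy⟩ x hxK
    have h5 : ‖y - x‖ ^ 2 ≤ 0 := nonpos_of_mul_nonpos_right (by linarith) hκ
    have h6 : ‖y - x‖ ^ 2 = 0 := le_antisymm h5 (by positivity)
    exact sub_eq_zero.1 (by simpa using h6)
  · have hEx : E x = E x₀ + β₂ := hxK.2
    obtain ⟨lam, hlam⟩ := exists_multiplier E hCcl hCcv hxK.1 (A x + a)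
      (fun c hc hEc => hVI c ⟨hc, hEc.trans hEx⟩) (fun w => by
        have hcont : Tendsto (fun t : ℝ => β₂ + t • w) (𝓝[>] 0) (𝓝 β₂) :=
          tendsto_nhdsWithin_of_tendsto_nhds (Continuous.tendsto' (by fun_prop) _ _ (by simp))
        obtain ⟨t, ht, htpos⟩ := ((hcont.eventually (isOpen_interior.mem_nhds hβ)).and
          self_mem_nhdsWithin).exists
        obtain ⟨c, hc, h⟩ := interior_subset ht
        refine ⟨t, htpos, c, hc, ?_⟩
        simp only [map_sub] at h
        rw [map_sub, hEx, ← sub_sub, h, add_sub_cancel_left])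
    refine ⟨lam, fun c hc => ?_, hEx⟩
    rw [inner_add_left, ContinuousLinearMap.adjoint_inner_left, add_comm a]
    exact hlam c hc
end

section
/- Let δ₀ > 0, γ > 0, and let Q : X → ℝ be a quadratic form (Q(x) = B(x, x) for a continuous symmetric bilinear form B on X). Suppose Q(h + z) ≥ δ₀ ‖h + z‖² for every h ∈ ker E and every z ∈ X with ‖z‖ ≤ γ ‖h‖, and suppose the orthogonal projections P onto ker E and P_q onto ker E_q satisfy ‖P_q − P‖ ≤ γ/(1 + γ). Then Q(x) ≥ δ₀ ‖x‖² for every x ∈ ker E_q. -/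
open scoped RealInnerProductSpace

/-- Transfer of a coercivity estimate for a quadratic form from
`ker E` (with a `γ`-cone of perturbations) to `ker E_q`, provided the orthogonal
projections `P` onto `ker E` and `Pq` onto `ker E_q` satisfy `‖Pq − P‖ ≤ γ/(1+γ)`.
The quadratic form is `Q x = B x x` for a continuous symmetric bilinear form `B`. -/
theorem stmt_6
    {X W : Type*} [NormedAddCommGroup X] [InnerProductSpace ℝ X] [CompleteSpace X]
    [NormedAddCommGroup W] [InnerProductSpace ℝ W] [CompleteSpace W]
    (E Eq : X →L[ℝ] W)
    (P Pq : X →L[ℝ] X)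
    (hPker : ∀ x : X, E (P x) = 0)
    (hPorth : ∀ x : X, ∀ v : X, E v = 0 → ⟪x - P x, v⟫ = 0)
    (hPqker : ∀ x : X, Eq (Pq x) = 0)
    (hPqorth : ∀ x : X, ∀ v : X, Eq v = 0 → ⟪x - Pq x, v⟫ = 0)
    (δ₀ γ : ℝ) (hδ₀ : 0 < δ₀) (hγ : 0 < γ)
    (B : X →L[ℝ] X →L[ℝ] ℝ) (hBsymm : ∀ x y : X, B x y = B y x)
    (hQ : ∀ h : X, E h = 0 → ∀ z : X, ‖z‖ ≤ γ * ‖h‖ →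
      δ₀ * ‖h + z‖ ^ 2 ≤ B (h + z) (h + z))
    (hnear : ‖Pq - P‖ ≤ γ / (1 + γ)) :
    ∀ x : X, Eq x = 0 → δ₀ * ‖x‖ ^ 2 ≤ B x x := by
  intro x hx
  have hfix : Pq x = x := by
    have hker : Eq (x - Pq x) = 0 := by rw [map_sub, hx, hPqker, sub_zero]
    exact (sub_eq_zero.mp (inner_self_eq_zero.mp (hPqorth x _ hker))).symm
  have hz : ‖x - P x‖ ≤ γ * ‖P x‖ := by
    have hle : ‖x - P x‖ ≤ γ / (1 + γ) * ‖x‖ := by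
      simpa [hfix] using (Pq - P).le_of_opNorm_le hnear x
    have htri : ‖x‖ ≤ ‖P x‖ + ‖x - P x‖ := by
      simpa using norm_add_le (P x) (x - P x)
    rw [div_mul_eq_mul_div, le_div_iff₀ (by positivity)] at hle
    linarith [mul_le_mul_of_nonneg_left htri hγ.le]
  simpa using hQ (P x) (hPker x) (x - P x) hz
end

section
/- Let u ∈ K and g ∈ H satisfy ⟨g, w − u⟩ ≥ 0 for all w ∈ K. Let (sₙ) be a sequence of positive reals with sₙ → 0, let uₙ ∈ K and gₙ ∈ H satisfy ⟨gₙ, w − uₙ⟩ ≥ 0 for all w ∈ K and all n, assume gₙ → g strongly in H, and assume that the difference quotients (uₙ − u)/sₙ converge weakly in H to some d. Then ⟨g, d⟩ = 0. -/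
open scoped RealInnerProductSpace
open Filter Topology

/-- A weakly convergent sequence in a Hilbert space is bounded in norm. -/
theorem exists_norm_le_of_tendsto_inner
    {H : Type*} [NormedAddCommGroup H] [InnerProductSpace ℝ H] [CompleteSpace H]
    {x : ℕ → H} {d : H} (hx : ∀ w : H, Tendsto (fun n => ⟪x n, w⟫) atTop (𝓝 ⟪d, w⟫)) :
    ∃ C, ∀ n, ‖x n‖ ≤ C := by
  obtain ⟨C, hC⟩ := banach_steinhaus (g := fun n => innerSL ℝ (x n)) fun w => by
    obtain ⟨C, hC⟩ := (hx w).norm.bddAbove_range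
    exact ⟨C, fun n => hC ⟨n, rfl⟩⟩
  exact ⟨C, fun n => by simpa using hC n⟩

/-- The inner product of a strongly and a weakly convergent sequence converges. -/
theorem tendsto_inner_of_tendsto_of_tendsto_inner
    {H : Type*} [NormedAddCommGroup H] [InnerProductSpace ℝ H] [CompleteSpace H]
    {x y : ℕ → H} {d g : H} (hy : Tendsto y atTop (𝓝 g))
    (hx : ∀ w : H, Tendsto (fun n => ⟪x n, w⟫) atTop (𝓝 ⟪d, w⟫)) :
    Tendsto (fun n => ⟪y n, x n⟫) atTop (𝓝 ⟪g, d⟫) := by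
  obtain ⟨C, hC⟩ := exists_norm_le_of_tendsto_inner hx
  have hdiff : Tendsto (fun n => ⟪y n - g, x n⟫) atTop (𝓝 0) := by
    have hlim : Tendsto (fun n => ‖y n - g‖ * C) atTop (𝓝 0) := by
      simpa using (tendsto_iff_norm_sub_tendsto_zero.mp hy).mul_const C
    refine squeeze_zero_norm (fun n => ?_) hlim
    exact (norm_inner_le_norm _ _).trans
      (mul_le_mul_of_nonneg_left (hC n) (norm_nonneg _))
  have hsum := hdiff.add (hx g)
  rw [zero_add, real_inner_comm] at hsum
  refine hsum.congr fun n => ?_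
  rw [inner_sub_left, real_inner_comm g (x n), sub_add_cancel]

/-- Orthogonality step in the differentiability proof for the value
function: if `u ∈ K` and `g` satisfy the variational inequality over `K`, `uₙ ∈ K` and
`gₙ` satisfy the corresponding variational inequalities, `gₙ → g` strongly, `sₙ → 0`
with `sₙ > 0`, and the difference quotients `(uₙ − u)/sₙ` converge weakly to `d`,
then `⟨g, d⟩ = 0`. -/
theorem stmt_10
    {H : Type*} [NormedAddCommGroup H] [InnerProductSpace ℝ H] [CompleteSpace H]
    (K : Set H) (hKne : K.Nonempty) (hKcl : IsClosed K) (hKcv : Convex ℝ K)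
    (u : H) (hu : u ∈ K) (g : H)
    (hg : ∀ w ∈ K, 0 ≤ ⟪g, w - u⟫)
    (s : ℕ → ℝ) (hspos : ∀ n, 0 < s n)
    (hs0 : Tendsto s atTop (𝓝 0))
    (un : ℕ → H) (hun : ∀ n, un n ∈ K)
    (gn : ℕ → H) (hgn : ∀ n, ∀ w ∈ K, 0 ≤ ⟪gn n, w - un n⟫)
    (hgconv : Tendsto gn atTop (𝓝 g))
    (d : H)
    (hweak : ∀ w : H,
      Tendsto (fun n => ⟪(s n)⁻¹ • (un n - u), w⟫) atTop (𝓝 ⟪d, w⟫)) :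
    ⟪g, d⟫ = 0 := by
  apply le_antisymm
  · refine le_of_tendsto' (tendsto_inner_of_tendsto_of_tendsto_inner hgconv hweak) fun n => ?_
    rw [real_inner_smul_right, ← neg_sub, inner_neg_right, mul_neg]
    exact neg_nonpos.mpr (mul_nonneg (inv_nonneg.mpr (hspos n).le) (hgn n u hu))
  · refine ge_of_tendsto'
      (tendsto_inner_of_tendsto_of_tendsto_inner tendsto_const_nhds hweak) fun n => ?_
    rw [real_inner_smul_right]
    exact mul_nonneg (inv_nonneg.mpr (hspos n).le) (hg _ (hun n))
end

section
/- Let ã ∈ X, b̃ ∈ W, suppose S(b̃) = {x ∈ C : E x = b̃} is nonempty, and let w ∈ (ker E)⊥ satisfy E w = b̃. Then every x ∈ S(b̃) satisfies x − w ∈ ker E and J̃(x) ≥ (κ/2)‖x − w‖² − (‖A‖‖w‖ + ‖ã‖)‖x − w‖ − ((1/2)‖A‖‖w‖² + ‖ã‖‖w‖); consequently J̃ is bounded from below on S(b̃) and every minimizing sequence of J̃ over S(b̃) is bounded in X. -/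
open scoped RealInnerProductSpace
open Filter Topology

/-- Lower bound for a quadratic functional at `w + v`, given coercivity in the direction `v`. -/
theorem quadratic_lower_bound {X : Type*} [NormedAddCommGroup X] [InnerProductSpace ℝ X]
    [CompleteSpace X] {A : X →L[ℝ] X} (hA : IsSelfAdjoint A) {κ : ℝ} (a w : X) {v : X}
    (hv : κ * ‖v‖ ^ 2 ≤ ⟪A v, v⟫) :
    κ / 2 * ‖v‖ ^ 2 - (‖A‖ * ‖w‖ + ‖a‖) * ‖v‖ -
        ((1 / 2) * ‖A‖ * ‖w‖ ^ 2 + ‖a‖ * ‖w‖) ≤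
      (1 / 2) * ⟪A (w + v), w + v⟫ + ⟪a, w + v⟫ := by
  have hsymm : ⟪A v, w⟫ = ⟪A w, v⟫ := by
    rw [real_inner_comm]
    exact (hA.isSymmetric w v).symm
  have hA_inner (y : X) : -(‖A‖ * ‖w‖ * ‖y‖) ≤ ⟪A w, y⟫ :=
    (abs_le.mp ((abs_real_inner_le_norm (A w) y).trans
      (mul_le_mul_of_nonneg_right (A.le_opNorm w) (norm_nonneg y)))).1
  have ha_inner (y : X) : -(‖a‖ * ‖y‖) ≤ ⟪a, y⟫ :=
    (abs_le.mp (abs_real_inner_le_norm a y)).1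
  simp only [map_add, inner_add_left, inner_add_right, hsymm]
  linarith [hA_inner w, hA_inner v, ha_inner w, ha_inner v]

/-- A real quadratic with positive leading coefficient is bounded below. -/
theorem neg_sq_div_le_quadratic {κ : ℝ} (hκ : 0 < κ) (b c t : ℝ) :
    -(b ^ 2 / (2 * κ)) - c ≤ κ / 2 * t ^ 2 - b * t - c := by
  have h : κ / 2 * t ^ 2 - b * t - c - (-(b ^ 2 / (2 * κ)) - c) =
      (κ * t - b) ^ 2 / (2 * κ) := by
    field_simp
    ring
  have : 0 ≤ (κ * t - b) ^ 2 / (2 * κ) := by positivity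
  linarith

/-- Sublevel sets of a real quadratic with positive leading coefficient are bounded above. -/
theorem le_of_quadratic_le {κ b c M t : ℝ} (hκ : 0 < κ) (hb : 0 ≤ b)
    (h : κ / 2 * t ^ 2 - b * t - c ≤ M) :
    t ≤ 1 + 2 * (b + |c + M|) / κ := by
  have hpos : 0 ≤ 2 * (b + |c + M|) / κ := by positivity
  rcases le_total t 1 with ht | ht
  · linarith
  · have : t ≤ 2 * (b + |c + M|) / κ := by
      rw [le_div_iff₀ hκ]
      have hM : c + M ≤ |c + M| * t :=
        (le_abs_self _).trans (le_mul_of_one_le_right (abs_nonneg _) ht)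
      refine le_of_mul_le_mul_right ?_ (zero_lt_one.trans_le ht)
      linarith
    linarith

/-- Coercivity lower bound for `J̃(x) = ½⟨Ax,x⟩ + ⟨a,x⟩` on
`S(bt) = {x ∈ C : E x = bt}`: writing `x = w + (x − w)` with `w ∈ (ker E)ᗮ`,
`E w = bt`, one has `x − w ∈ ker E` and the quadratic lower bound; consequently `J̃`
is bounded below on `S(bt)` and every minimizing sequence of `J̃` over `S(bt)` is
bounded. -/
theorem stmt_11
    {X W : Type*} [NormedAddCommGroup X] [InnerProductSpace ℝ X] [CompleteSpace X]
    [NormedAddCommGroup W] [InnerProductSpace ℝ W] [CompleteSpace W]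
    (A : X →L[ℝ] X) (hA : IsSelfAdjoint A)
    (E : X →L[ℝ] W)
    (C : Set X) (hCne : C.Nonempty) (hCcl : IsClosed C) (hCcv : Convex ℝ C)
    (κ : ℝ) (hκ : 0 < κ)
    (hcoer : ∀ x : X, E x = 0 → κ * ‖x‖ ^ 2 ≤ ⟪A x, x⟫)
    (a : X) (bt : W)
    (hS : ∃ x ∈ C, E x = bt)
    (w : X) (hworth : ∀ v : X, E v = 0 → ⟪w, v⟫ = 0) (hwE : E w = bt) :
    (∀ x : X, x ∈ C → E x = bt →
      E (x - w) = 0 ∧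
      κ / 2 * ‖x - w‖ ^ 2 - (‖A‖ * ‖w‖ + ‖a‖) * ‖x - w‖ -
          ((1 / 2) * ‖A‖ * ‖w‖ ^ 2 + ‖a‖ * ‖w‖) ≤
        (1 / 2) * ⟪A x, x⟫ + ⟪a, x⟫) ∧
    BddBelow ((fun x => (1 / 2) * ⟪A x, x⟫ + ⟪a, x⟫) '' {x | x ∈ C ∧ E x = bt}) ∧
    (∀ x : ℕ → X, (∀ n, x n ∈ C ∧ E (x n) = bt) →
      Tendsto (fun n => (1 / 2) * ⟪A (x n), x n⟫ + ⟪a, x n⟫) atTop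
        (𝓝 (sInf ((fun y => (1 / 2) * ⟪A y, y⟫ + ⟪a, y⟫) '' {y | y ∈ C ∧ E y = bt}))) →
      ∃ M : ℝ, ∀ n, ‖x n‖ ≤ M) := by
  have hbound : ∀ x : X, x ∈ C → E x = bt →
      E (x - w) = 0 ∧
      κ / 2 * ‖x - w‖ ^ 2 - (‖A‖ * ‖w‖ + ‖a‖) * ‖x - w‖ -
          ((1 / 2) * ‖A‖ * ‖w‖ ^ 2 + ‖a‖ * ‖w‖) ≤
        (1 / 2) * ⟪A x, x⟫ + ⟪a, x⟫ := by
    intro x _ hx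
    have hker : E (x - w) = 0 := by rw [map_sub, hx, hwE, sub_self]
    refine ⟨hker, ?_⟩
    simpa only [add_sub_cancel] using quadratic_lower_bound hA a w (hcoer _ hker)
  refine ⟨hbound, ?_, ?_⟩
  · refine ⟨-((‖A‖ * ‖w‖ + ‖a‖) ^ 2 / (2 * κ)) -
      ((1 / 2) * ‖A‖ * ‖w‖ ^ 2 + ‖a‖ * ‖w‖), ?_⟩
    rintro _ ⟨x, ⟨hxC, hxE⟩, rfl⟩
    exact (neg_sq_div_le_quadratic hκ _ _ _).trans (hbound x hxC hxE).2
  · intro x hx hlim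
    obtain ⟨M, hM⟩ := hlim.bddAbove_range
    refine ⟨_, fun n => (norm_le_norm_sub_add (x n) w).trans (add_le_add_left
      (le_of_quadratic_le hκ (by positivity)
        ((hbound (x n) (hx n).1 (hx n).2).2.trans (hM ⟨n, rfl⟩))) ‖w‖)⟩
end
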